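/- Let G be a connected tricyclic graph of order n ≥ 29. Then Sz*(G) ≤ (n³ + 2n² − 16)/4 if n is even, and Sz*(G) ≤ (n³ + 2n² − 18)/4 if n is odd. -/

import Mathlib

attribute [local instance] Classical.propDecidable

noncomputable def nC {V : Type*} [Fintype V] (G : SimpleGraph V) (u v : V) : ℕ :=
  (Finset.univ.filter fun w => G.dist u w < G.dist v w).card

noncomputable def nE {V : Type*} [Fintype V] (G : SimpleGraph V) (u v : V) : ℕ :=
  (Finset.univ.filter fun w => G.dist u w = G.dist v w).card

lemma nE_comm {V : Type*} [Fintype V] (G : SimpleGraph V) (u v : V) :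
    nE G u v = nE G v u := by
  unfold nE; congr 1; ext w; simp [eq_comm]

noncomputable def szContrib {V : Type*} [Fintype V] (G : SimpleGraph V) : Sym2 V → ℚ :=
  Sym2.lift ⟨fun u v =>
    ((nC G u v : ℚ) + (nE G u v : ℚ) / 2) * ((nC G v u : ℚ) + (nE G u v : ℚ) / 2),
    fun u v => by dsimp only; rw [nE_comm]; ring⟩

noncomputable def revSz {V : Type*} [Fintype V] (G : SimpleGraph V) : ℚ :=
  ∑ e ∈ G.edgeFinset, szContrib G e


open Finset SimpleGraph

/-- The sum of the distances from `v` to all the vertices. -/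
noncomputable def transmission {V : Type*} [Fintype V] (G : SimpleGraph V) (v : V) : ℤ :=
  ∑ x, (G.dist v x : ℤ)

/-- The squared difference of the transmissions of the ends of an edge. -/
noncomputable def edgeEnergy {V : Type*} [Fintype V] (G : SimpleGraph V) : Sym2 V → ℤ :=
  Sym2.lift ⟨fun u v => (transmission G u - transmission G v) ^ 2, fun u v => by ring⟩

noncomputable def energy {V : Type*} [Fintype V] (G : SimpleGraph V) : ℤ :=
  ∑ e ∈ G.edgeFinset, edgeEnergy G e

set_option linter.unusedSectionVars false

section Basic

variable {V : Type*} [Fintype V] {G : SimpleGraph V}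

@[simp] lemma edgeEnergy_mk (u v : V) :
    edgeEnergy G s(u, v) = (transmission G u - transmission G v) ^ 2 := rfl

lemma edgeEnergy_nonneg (e : Sym2 V) : 0 ≤ edgeEnergy G e := by
  induction e with
  | h u v => simpa using sq_nonneg _

lemma dist_le_succ_of_adj (hc : G.Connected) {u v : V} (h : G.Adj u v) (x : V) :
    G.dist u x ≤ G.dist v x + 1 := by
  have := hc.dist_triangle (u := u) (v := v) (w := x)
  rw [dist_eq_one_iff_adj.2 h] at this
  omega

lemma nC_sub_nC (hc : G.Connected) {u v : V} (h : G.Adj u v) :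
    (nC G u v : ℤ) - nC G v u = transmission G v - transmission G u := by
  unfold nC transmission
  rw [card_filter, card_filter, ← sum_sub_distrib]
  push_cast
  rw [← sum_sub_distrib]
  refine sum_congr rfl fun x _ => ?_
  have h1 := dist_le_succ_of_adj hc h x
  have h2 := dist_le_succ_of_adj hc h.symm x
  split_ifs <;> omega

lemma nC_add_nC_add_nE (u v : V) : nC G u v + nC G v u + nE G u v = Fintype.card V := by
  unfold nC nE
  rw [card_filter, card_filter, card_filter, ← sum_add_distrib, ← sum_add_distrib,
    ← card_univ, card_eq_sum_ones]
  refine sum_congr rfl fun x _ => ?_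
  split_ifs <;> omega

lemma szContrib_eq (hc : G.Connected) {e : Sym2 V} (he : e ∈ G.edgeSet) :
    szContrib G e = ((Fintype.card V : ℚ) ^ 2 - edgeEnergy G e) / 4 := by
  induction e with
  | h u v =>
    have h1 := nC_sub_nC hc (G.mem_edgeSet.1 he)
    have h2 := nC_add_nC_add_nE (G := G) u v
    have h1' : (nC G u v : ℚ) - nC G v u = transmission G v - transmission G u := by
      exact_mod_cast h1
    have h2' : (nC G u v : ℚ) + nC G v u + nE G u v = Fintype.card V := by exact_mod_cast h2
    have h3 : (edgeEnergy G s(u, v) : ℚ) = ((nC G u v : ℚ) - nC G v u) ^ 2 := by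
      rw [h1']; simp; ring
    rw [h3, ← h2']
    simp only [szContrib, Sym2.lift_mk]
    ring

lemma revSz_eq (hc : G.Connected) :
    revSz G = (G.edgeFinset.card * (Fintype.card V : ℚ) ^ 2 - energy G) / 4 := by
  unfold revSz energy
  rw [sum_congr rfl fun e he => szContrib_eq hc (mem_edgeFinset.1 he), ← sum_div,
    sum_sub_distrib]
  simp

lemma dist_add_dist_le_of_mem_support {u v x : V} (p : G.Walk u v) (h : x ∈ p.support) :
    G.dist u x + G.dist x v ≤ p.length := by
  have := congrArg Walk.length (p.take_spec h)
  rw [Walk.length_append] at this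
  have h1 := dist_le (p.takeUntil x h)
  have h2 := dist_le (p.dropUntil x h)
  omega

lemma sq_transmission_sub_le_walk {u v : V} (p : G.Walk u v) :
    (transmission G u - transmission G v) ^ 2 ≤
      p.length * (p.edges.map (edgeEnergy G)).sum := by
  induction p with
  | nil => simp
  | @cons a b c h p ih =>
    simp only [Walk.length_cons, Walk.edges_cons, List.map_cons, List.sum_cons, edgeEnergy_mk]
    set s := (p.edges.map (edgeEnergy G)).sum
    have hs : 0 ≤ s := List.sum_nonneg (by simpa using fun e _ => edgeEnergy_nonneg e)
    push_cast
    set k : ℤ := (p.length : ℤ)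
    have hk : 0 ≤ k := by positivity
    set α := transmission G a - transmission G b
    set β := transmission G b - transmission G c
    have h3 : transmission G a - transmission G c = α + β := by ring
    rw [h3]
    rcases hk.eq_or_lt with hk | hk
    · have : β = 0 := by rw [← hk] at ih; nlinarith
      rw [this, ← hk]; nlinarith
    · have : 0 ≤ (k * α - β) ^ 2 := sq_nonneg _
      have : 0 ≤ k * ((k + 1) * (α ^ 2 + s) - (α + β) ^ 2) := by nlinarith
      nlinarith [nonneg_of_mul_nonneg_right this hk]

lemma sq_transmission_sub_le (hc : G.Connected) (u v : V) :
    (transmission G u - transmission G v) ^ 2 ≤ G.dist u v * energy G := by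
  obtain ⟨p, hp, hl⟩ := hc.exists_path_of_dist u v
  refine (sq_transmission_sub_le_walk p).trans ?_
  rw [hl]
  refine mul_le_mul_of_nonneg_left ?_ (by positivity)
  rw [← List.sum_toFinset _ hp.isTrail.edges_nodup]
  refine sum_le_sum_of_subset_of_nonneg ?_ fun e _ _ => edgeEnergy_nonneg e
  intro e he
  exact mem_edgeFinset.2 (p.edges_subset_edgeSet (List.mem_toFinset.1 he))

/-- A separation of `G` at the vertex `v`. -/
structure IsCutAt (G : SimpleGraph V) (v : V) (A B : Finset V) : Prop where
  not_mem_left : v ∉ A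
  not_mem_right : v ∉ B
  disj : Disjoint A B
  cover : ∀ x, x = v ∨ x ∈ A ∨ x ∈ B
  left_nonempty : A.Nonempty
  right_nonempty : B.Nonempty
  not_adj : ∀ a ∈ A, ∀ b ∈ B, ¬ G.Adj a b

lemma IsCutAt.symm {v : V} {A B : Finset V} (h : IsCutAt G v A B) : IsCutAt G v B A :=
  ⟨h.not_mem_right, h.not_mem_left, h.disj.symm, fun x => by have := h.cover x; tauto,
    h.right_nonempty, h.left_nonempty, fun a ha b hb hab => h.not_adj b hb a ha hab.symm⟩

lemma IsCutAt.dist_eq (hc : G.Connected) {v : V} {A B : Finset V} (h : IsCutAt G v A B)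
    {u x : V} (hu : u ∈ A) (hx : x ∉ A) : G.dist u x = G.dist u v + G.dist v x := by
  refine le_antisymm hc.dist_triangle ?_
  obtain ⟨p, hp⟩ := hc.exists_walk_length_eq_dist u x
  rw [← hp]
  apply dist_add_dist_le_of_mem_support
  obtain ⟨d, hd, h1, h2⟩ := p.exists_boundary_dart (A : Set V) (by simpa) (by simpa)
  rcases h.cover d.snd with h3 | h3 | h3
  · exact h3 ▸ p.dart_snd_mem_support_of_mem_darts hd
  · exact absurd h3 h2
  · exact absurd d.adj (h.not_adj _ h1 _ h3)

lemma IsCutAt.energy_ge_of_card_le (hc : G.Connected) (hn : 29 ≤ Fintype.card V) {v : V}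
    {A B : Finset V} (h : IsCutAt G v A B) (hAB : A.card ≤ B.card) : 18 ≤ energy G := by
  obtain ⟨u, hu, hmax⟩ := exists_max_image A (fun x => G.dist v x) h.left_nonempty
  have hcov : (univ : Finset V) = insert v (A ∪ B) := by
    ext x; simpa using h.cover x
  have hv : v ∉ A ∪ B := by simp [h.not_mem_left, h.not_mem_right]
  have hcard : Fintype.card V = A.card + B.card + 1 := by
    rw [← card_univ, hcov, card_insert_of_notMem hv, card_union_of_disjoint h.disj]
  set l : ℤ := (G.dist v u : ℤ) with hl
  have hl1 : 1 ≤ l := by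
    have := hc.pos_dist_of_ne (u := v) (v := u) (by rintro rfl; exact h.not_mem_left hu)
    omega
  have hf : transmission G u - transmission G v ≥ 13 + l := by
    unfold transmission
    rw [← sum_sub_distrib, hcov, sum_insert hv, sum_union h.disj]
    have hB : ∑ x ∈ B, ((G.dist u x : ℤ) - G.dist v x) = B.card * l := by
      rw [← nsmul_eq_mul, ← sum_const]
      refine sum_congr rfl fun x hx => ?_
      rw [h.dist_eq hc hu (disjoint_right.1 h.disj hx), dist_comm (u := u) (v := v)]
      push_cast; ring
    have hA : ∑ x ∈ A.erase u, ((G.dist u x : ℤ) - G.dist v x) ≥ (A.card - 1) * (1 - l) := by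
      have : ∑ x ∈ A.erase u, (1 - l) ≤ ∑ x ∈ A.erase u, ((G.dist u x : ℤ) - G.dist v x) := by
        refine sum_le_sum fun x hx => ?_
        have h1 := hmax x (mem_of_mem_erase hx)
        have h2 := hc.pos_dist_of_ne (ne_of_mem_erase hx).symm
        omega
      rw [sum_const, card_erase_of_mem hu, nsmul_eq_mul,
        Nat.cast_sub (card_pos.2 ⟨u, hu⟩)] at this
      simpa using this
    rw [hB, ← add_sum_erase A _ hu, dist_comm (u := u) (v := v), ← hl]
    simp only [SimpleGraph.dist_self]
    have h1 : (A.card : ℤ) ≤ B.card := by exact_mod_cast hAB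
    have h2 : (14 : ℤ) ≤ B.card := by omega
    push_cast
    nlinarith
  have h2 := sq_transmission_sub_le hc u v
  rw [dist_comm, ← hl] at h2
  have h3 : (13 + l) ^ 2 ≤ (transmission G u - transmission G v) ^ 2 := by nlinarith
  by_contra hE
  push Not at hE
  nlinarith

lemma IsCutAt.energy_ge (hc : G.Connected) (hn : 29 ≤ Fintype.card V) {v : V}
    {A B : Finset V} (h : IsCutAt G v A B) : 18 ≤ energy G := by
  rcases le_total A.card B.card with h' | h'
  · exact h.energy_ge_of_card_le hc hn h'
  · exact h.symm.energy_ge_of_card_le hc hn h'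

lemma exists_walk_avoiding (hc : G.Connected) (hn : 29 ≤ Fintype.card V) (hE : energy G ≤ 17)
    {v a b : V} (ha : a ≠ v) (hb : b ≠ v) : ∃ p : G.Walk a b, v ∉ p.support := by
  by_contra! hab
  let A : Finset V := univ.filter fun x => ∃ p : G.Walk a x, v ∉ p.support
  let B : Finset V := univ.filter fun x => x ≠ v ∧ x ∉ A
  have hA : ∀ x, x ∈ A ↔ ∃ p : G.Walk a x, v ∉ p.support := by simp [A]
  have hB : ∀ x, x ∈ B ↔ x ≠ v ∧ x ∉ A := by simp [B]
  have hvA : v ∉ A := by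
    rw [hA]; rintro ⟨p, hp⟩; exact hp p.end_mem_support
  have : IsCutAt G v A B :=
    { not_mem_left := hvA
      not_mem_right := by simp [hB]
      disj := disjoint_right.2 fun x hx => ((hB x).1 hx).2
      cover := fun x => by rw [hB]; tauto
      left_nonempty := ⟨a, (hA a).2 ⟨Walk.nil, by simpa using ha.symm⟩⟩
      right_nonempty := ⟨b, (hB b).2 ⟨hb, by rw [hA]; push Not; exact hab⟩⟩
      not_adj := by
        intro x hx z hz hxz
        obtain ⟨p, hp⟩ := (hA x).1 hx
        refine ((hB z).1 hz).2 ((hA z).2 ⟨p.concat hxz, ?_⟩)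
        simp [Walk.support_concat, hp, ((hB z).1 hz).1.symm] }
  have := this.energy_ge hc hn
  omega

end Basic

/-- A connected tricyclic graph of order at least `29` whose energy is at most `17`. -/
structure LowEnergy {V : Type*} [Fintype V] (G : SimpleGraph V) : Prop where
  conn : G.Connected
  card_edges : G.edgeFinset.card = Fintype.card V + 2
  large : 29 ≤ Fintype.card V
  low : energy G ≤ 17

section Walks

variable {V : Type*} [Fintype V] {G : SimpleGraph V}

lemma exists_zero_or_sign_change {a b : V} (p : G.Walk a b) (g : V → ℤ)
    (hg : ∀ x x', G.Adj x x' → |g x - g x'| ≤ 2) (ha : 0 ≤ g a) (hb : g b ≤ 0) :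
    (∃ x ∈ p.support, g x = 0) ∨
      ∃ x ∈ p.support, ∃ x' ∈ p.support, G.Adj x x' ∧ g x = 1 ∧ g x' = -1 := by
  rcases ha.eq_or_lt with ha | ha
  · exact Or.inl ⟨a, p.start_mem_support, ha.symm⟩
  obtain ⟨d, hd, h1, h2⟩ := p.exists_boundary_dart {x | 0 < g x} ha (by simpa using hb)
  simp only [Set.mem_ofPred_eq, not_lt] at h1 h2
  rcases h2.eq_or_lt with h2 | h2
  · exact Or.inl ⟨d.snd, p.dart_snd_mem_support_of_mem_darts hd, h2⟩
  · have := abs_le.1 (hg _ _ d.adj)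
    exact Or.inr ⟨d.fst, p.dart_fst_mem_support_of_mem_darts hd, d.snd,
      p.dart_snd_mem_support_of_mem_darts hd, d.adj, by omega, by omega⟩

lemma exists_adj_mem_support {a b : V} (p : G.Walk a b) (h : a ≠ b) :
    ∃ r ∈ p.support, G.Adj a r := by
  cases p with
  | nil => exact absurd rfl h
  | cons h p => exact ⟨_, by simp, h⟩

lemma exists_closer_neighbor (hc : G.Connected) {a b : V} (h : a ≠ b) :
    ∃ r, G.Adj a r ∧ G.dist a b = G.dist r b + 1 := by
  obtain ⟨p, hp⟩ := hc.exists_walk_length_eq_dist a b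
  cases p with
  | nil => exact absurd rfl h
  | @cons _ r _ har p =>
    refine ⟨r, har, ?_⟩
    have h1 := dist_le p
    have h2 := dist_le_succ_of_adj hc har b
    simp only [Walk.length_cons] at hp
    omega

lemma abs_dist_sub_dist_le (hc : G.Connected) (p q x : V) :
    |(G.dist q x : ℤ) - G.dist p x| ≤ G.dist p q := by
  have h1 := hc.dist_triangle (u := p) (v := q) (w := x)
  have h2 := hc.dist_triangle (u := q) (v := p) (w := x)
  rw [dist_comm (u := q) (v := p)] at h2
  rw [abs_le]; omega

lemma abs_dist_diff_le (hc : G.Connected) (p q : V) {x x' : V} (h : G.Adj x x') :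
    |((G.dist p x : ℤ) - G.dist q x) - (G.dist p x' - G.dist q x')| ≤ 2 := by
  have h1 := dist_le_succ_of_adj hc h p
  have h2 := dist_le_succ_of_adj hc h q
  have h3 := dist_le_succ_of_adj hc h.symm p
  have h4 := dist_le_succ_of_adj hc h.symm q
  simp only [dist_comm (v := p), dist_comm (v := q)] at h1 h2 h3 h4
  rw [abs_le]; omega

/-- The vertex `y` has exactly the two neighbours `u` and `w`. -/
structure IsBivalent (G : SimpleGraph V) (y u w : V) : Prop where
  ne : u ≠ w
  adj_iff : ∀ x, G.Adj y x ↔ x = u ∨ x = w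

namespace IsBivalent

variable {y u w : V}

lemma symm (h : IsBivalent G y u w) : IsBivalent G y w u :=
  ⟨h.ne.symm, fun x => by rw [h.adj_iff, or_comm]⟩

lemma adj_left (h : IsBivalent G y u w) : G.Adj y u := (h.adj_iff u).2 (Or.inl rfl)

lemma adj_right (h : IsBivalent G y u w) : G.Adj y w := (h.adj_iff w).2 (Or.inr rfl)

lemma dist_eq (hc : G.Connected) (h : IsBivalent G y u w) {x : V} (hx : x ≠ y) :
    G.dist y x = min (G.dist u x) (G.dist w x) + 1 := by
  have h1 := dist_le_succ_of_adj hc h.adj_left x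
  have h2 := dist_le_succ_of_adj hc h.adj_right x
  obtain ⟨r, hr, h3⟩ := exists_closer_neighbor hc hx.symm
  rcases (h.adj_iff r).1 hr with rfl | rfl <;> omega

lemma slack_eq (hc : G.Connected) (h : IsBivalent G y u w) {x : V} (hx : x ≠ y) :
    2 * (G.dist y x : ℤ) - G.dist u x - G.dist w x = 2 - |(G.dist w x : ℤ) - G.dist u x| := by
  have := h.dist_eq hc hx
  rcases abs_cases ((G.dist w x : ℤ) - G.dist u x) with h | h <;> omega

lemma dist_le_two (hc : G.Connected) (h : IsBivalent G y u w) : G.dist u w ≤ 2 := by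
  have := dist_le_succ_of_adj hc h.adj_left.symm w
  rw [dist_eq_one_iff_adj.2 h.adj_right] at this
  exact this

lemma abs_le_two (hc : G.Connected) (h : IsBivalent G y u w) (x : V) :
    |(G.dist w x : ℤ) - G.dist u x| ≤ 2 :=
  (abs_dist_sub_dist_le hc u w x).trans (by exact_mod_cast h.dist_le_two hc)

lemma slack_nonneg (hc : G.Connected) (h : IsBivalent G y u w) {x : V} (hx : x ≠ y) :
    0 ≤ 2 * (G.dist y x : ℤ) - G.dist u x - G.dist w x := by
  rw [h.slack_eq hc hx]
  linarith [h.abs_le_two hc x]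

lemma slack_self (h : IsBivalent G y u w) :
    2 * (G.dist y y : ℤ) - G.dist u y - G.dist w y = -2 := by
  rw [dist_eq_one_iff_adj.2 h.adj_left.symm, dist_eq_one_iff_adj.2 h.adj_right.symm]
  simp

lemma exists_balanced (hc : G.Connected) (p : G.Walk u w) :
    (∃ x ∈ p.support, (G.dist w x : ℤ) - G.dist u x = 0) ∨
      ∃ x ∈ p.support, ∃ x' ∈ p.support, G.Adj x x' ∧ (G.dist w x : ℤ) - G.dist u x = 1 ∧
        (G.dist w x' : ℤ) - G.dist u x' = -1 :=
  exists_zero_or_sign_change p (fun x => (G.dist w x : ℤ) - G.dist u x)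
    (fun _ _ h => abs_dist_diff_le hc w u h) (by simp) (by simp)

lemma sum_slack_nonneg (hc : G.Connected) (h : IsBivalent G y u w) {S : Finset V}
    (p : G.Walk u w) (hp : y ∉ p.support) (hS : ∀ x ∈ p.support, x ∈ S) (hy : y ∈ S) :
    0 ≤ ∑ x ∈ S, (2 * (G.dist y x : ℤ) - G.dist u x - G.dist w x) := by
  rw [← add_sum_erase S _ hy, h.slack_self]
  have hnn : ∀ x ∈ S.erase y, 0 ≤ 2 * (G.dist y x : ℤ) - G.dist u x - G.dist w x :=
    fun x hx => h.slack_nonneg hc (ne_of_mem_erase hx)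
  have hmem : ∀ x ∈ p.support, x ∈ S.erase y := fun x hx =>
    mem_erase.2 ⟨fun e => hp (e ▸ hx), hS x hx⟩
  rcases exists_balanced hc p with ⟨x, hx, h0⟩ | ⟨x, hx, x', hx', hxx, h1, h2⟩
  · have := single_le_sum hnn (hmem x hx)
    rw [h.slack_eq hc (ne_of_mem_erase (hmem x hx)), h0] at this
    simp only [abs_zero] at this
    linarith
  · have hs := h.slack_eq hc (ne_of_mem_erase (hmem x hx))
    have hs' := h.slack_eq hc (ne_of_mem_erase (hmem x' hx'))
    rw [h1] at hs
    rw [h2] at hs'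
    have := add_le_sum hnn (hmem x hx) (hmem x' hx') hxx.ne
    norm_num at hs hs'
    linarith

end IsBivalent

end Walks

section ZeroVertex

variable {V : Type*} [Fintype V] {G : SimpleGraph V}

lemma sum_sum_neighborFinset_edge (g : Sym2 V → ℤ) :
    ∑ v, ∑ r ∈ G.neighborFinset v, g s(v, r) = 2 * ∑ e ∈ G.edgeFinset, g e := by
  have h1 : ∑ v, ∑ r ∈ G.neighborFinset v, g s(v, r) = ∑ d : G.Dart, g d.edge := by
    rw [sum_sigma']
    refine sum_bij' (fun a ha => ⟨(a.1, a.2), by simpa using ha⟩) (fun d _ => ⟨d.fst, d.snd⟩)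
      ?_ ?_ ?_ ?_ ?_ <;> simp [Dart.edge, Dart.adj]
  rw [h1, ← sum_fiberwise_of_maps_to (s := univ) (t := G.edgeFinset) (g := fun d : G.Dart => d.edge)
    (fun d _ => mem_edgeFinset.2 d.edge_mem), mul_sum]
  refine sum_congr rfl fun e he => ?_
  rw [sum_congr rfl (g := fun _ => g e) fun d hd => by rw [(mem_filter.1 hd).2], sum_const,
    nsmul_eq_mul]
  have := G.dart_edge_fiber_card e (mem_edgeFinset.1 he)
  congr 1
  exact_mod_cast (by convert this)

lemma sum_sum_neighborFinset_comm (g : V → V → ℤ) :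
    ∑ v, ∑ r ∈ G.neighborFinset v, g v r = ∑ v, ∑ r ∈ G.neighborFinset v, g r v := by
  refine sum_comm' fun x y => ?_
  simp [adj_comm]

namespace LowEnergy

lemma exists_walk (h : LowEnergy G) {v a b : V} (ha : a ≠ v) (hb : b ≠ v) :
    ∃ p : G.Walk a b, v ∉ p.support :=
  exists_walk_avoiding h.conn h.large h.low ha hb

lemma exists_neighbor_ne (h : LowEnergy G) {v r : V} (hv : v ≠ r) : ∃ s, G.Adj v s ∧ s ≠ r := by
  obtain ⟨c, hc⟩ : ∃ c, c ∉ ({v, r} : Finset V) := by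
    by_contra! hc
    have := card_le_card (fun x _ => hc x : (univ : Finset V) ⊆ {v, r})
    have h2 := card_le_two (a := v) (b := r)
    have := h.large
    rw [card_univ] at *
    omega
  simp only [mem_insert, mem_singleton, not_or] at hc
  obtain ⟨p, hp⟩ := h.exists_walk hv hc.2
  obtain ⟨s, hs, hvs⟩ := exists_adj_mem_support p (Ne.symm hc.1)
  exact ⟨s, hvs, fun e => hp (e ▸ hs)⟩

lemma two_le_degree (h : LowEnergy G) (v : V) : 2 ≤ G.degree v := by
  have : Nontrivial V := Fintype.one_lt_card_iff_nontrivial.1 (by have := h.large; omega)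
  obtain ⟨x, hx⟩ := exists_ne v
  obtain ⟨p⟩ := h.conn.preconnected v x
  obtain ⟨r, -, hr⟩ := exists_adj_mem_support p hx.symm
  obtain ⟨s, hs, hsr⟩ := h.exists_neighbor_ne hr.ne
  rw [← card_neighborFinset_eq_degree]
  refine one_lt_card.2 ⟨r, by simpa, s, by simpa, hsr.symm⟩

lemma isBivalent_of_degree {v : V} (h : G.degree v = 2) : ∃ u w, IsBivalent G v u w := by
  rw [← card_neighborFinset_eq_degree, card_eq_two] at h
  obtain ⟨u, w, hne, huw⟩ := h
  exact ⟨u, w, hne, fun x => by rw [← mem_neighborFinset, huw]; simp⟩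

lemma neighborFinset_eq {y u w : V} (h : IsBivalent G y u w) : G.neighborFinset y = {u, w} := by
  ext x; simp [h.adj_iff]

lemma two_mul_transmission_ge (h : LowEnergy G) {y u w : V} (hy : IsBivalent G y u w) :
    transmission G u + transmission G w ≤ 2 * transmission G y := by
  obtain ⟨p, hp⟩ := h.exists_walk hy.adj_left.ne' hy.adj_right.ne'
  have := hy.sum_slack_nonneg h.conn p hp (S := univ) (by simp) (mem_univ _)
  rw [sum_sub_distrib, sum_sub_distrib, ← mul_sum] at this
  unfold transmission
  linarith

lemma sum_degree (h : LowEnergy G) : ∑ v, (G.degree v : ℤ) = 2 * (Fintype.card V + 2) := by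
  have := G.sum_degrees_eq_twice_card_edges
  rw [h.card_edges] at this
  exact_mod_cast this

lemma exists_flat_vertex (h : LowEnergy G) : ∃ y u w, IsBivalent G y u w ∧
    transmission G u = transmission G y ∧ transmission G w = transmission G y := by
  by_contra! hno
  set f := transmission G
  have key : ∀ v, 6 - 2 * (G.degree v : ℤ) ≤
      ∑ r ∈ G.neighborFinset v, ((f v - f r) ^ 2 + (f v - f r).sign) := by
    intro v
    have hpos : ∀ t : ℤ, 0 ≤ t ^ 2 + t.sign := by
      intro t
      rcases lt_trichotomy t 0 with ht | rfl | ht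
      · rw [Int.sign_eq_neg_one_of_neg ht]; nlinarith
      · simp
      · rw [Int.sign_eq_one_of_pos ht]; positivity
    have hpos' : ∀ t : ℤ, 0 < t → 2 ≤ t ^ 2 + t.sign := by
      intro t ht
      rw [Int.sign_eq_one_of_pos ht]; nlinarith
    rcases (h.two_le_degree v).eq_or_lt with h2 | h2
    · obtain ⟨u, w, hv⟩ := isBivalent_of_degree h2.symm
      rw [neighborFinset_eq hv, sum_pair hv.ne, ← h2]
      have h3 := h.two_mul_transmission_ge hv
      have h4 := hno v u w hv
      have h5 : 0 < f v - f u ∨ 0 < f v - f w := by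
        change f u + f w ≤ 2 * f v at h3
        change f u = f v → f w ≠ f v at h4
        by_contra! h6
        exact h4 (by omega) (by omega)
      have := hpos (f v - f u)
      have := hpos (f v - f w)
      rcases h5 with h5 | h5
      · have := hpos' _ h5
        push_cast; linarith
      · have := hpos' _ h5
        push_cast; linarith
    · exact le_trans (by omega) (sum_nonneg fun r _ => hpos _)
  have hsum := sum_le_sum fun v (_ : v ∈ univ) => key v
  rw [sum_sub_distrib, ← mul_sum, h.sum_degree] at hsum
  simp only [sum_add_distrib] at hsum
  have hE := sum_sum_neighborFinset_edge (G := G) (edgeEnergy G)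
  simp only [edgeEnergy_mk] at hE
  have hs := sum_sum_neighborFinset_comm (G := G) (fun v r => (f v - f r).sign)
  have hs2 : ∑ v, ∑ r ∈ G.neighborFinset v, (f r - f v).sign =
      - ∑ v, ∑ r ∈ G.neighborFinset v, (f v - f r).sign := by
    simp only [← sum_neg_distrib]
    refine sum_congr rfl fun v _ => sum_congr rfl fun r _ => ?_
    rw [← Int.sign_neg, neg_sub]
  change _ = 2 * energy G at hE
  have := h.low
  have := h.large
  simp only [sum_const, card_univ, nsmul_eq_mul] at hsum
  zify at this
  linarith

end LowEnergy

end ZeroVertex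

/-- The shape of `G` around a bivalent vertex `y` at which the transmission is flat: the other
vertices are divided into those closer to `u` and those closer to `w`, and the two parts meet
either in a single vertex (`ε = 0`) or along a single edge (`ε = 1`). -/
structure Split {V : Type*} [Fintype V] (G : SimpleGraph V) (y u w e e' : V) (ε : ℕ)
    (A A' : Finset V) : Prop where
  bivalent : IsBivalent G y u w
  mem_left : ∀ x, x ∈ A ↔ x ≠ y ∧ G.dist y x = G.dist u x + 1
  mem_right : ∀ x, x ∈ A' ↔ x ≠ y ∧ G.dist y x = G.dist w x + 1
  left_mem : e ∈ A
  right_mem : e' ∈ A'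
  inter : ∀ x, x ∈ A → x ∈ A' → x = e ∧ x = e' ∧ ε = 0
  kind : (ε = 0 ∧ e = e' ∧ e ≠ u ∧ e ≠ w) ∨ (ε = 1 ∧ G.Adj e e')
  cross : ∀ x x', x ∈ A → x ∉ A' → x' ∈ A' → x' ∉ A → G.Adj x x' → x = e ∧ x' = e'
  dist_eq : G.dist y e = G.dist y e'
  card_eq : A.card = A'.card
  card : Fintype.card V = 2 * A.card + ε

section SplitExists

variable {V : Type*} [Fintype V] {G : SimpleGraph V}

namespace IsBivalent

variable {y u w : V}

lemma eq_two_of_slack (hc : G.Connected) (hy : IsBivalent G y u w)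
    (hu : transmission G u = transmission G y) (hw : transmission G w = transmission G y)
    {S : Finset V} (hS : y ∉ S)
    (hsum : 2 ≤ ∑ x ∈ S, (2 * (G.dist y x : ℤ) - G.dist u x - G.dist w x)) {x : V}
    (hx : x ≠ y) (hxS : x ∉ S) : |(G.dist w x : ℤ) - G.dist u x| = 2 := by
  have htot : ∑ x, (2 * (G.dist y x : ℤ) - G.dist u x - G.dist w x) = 0 := by
    rw [sum_sub_distrib, sum_sub_distrib, ← mul_sum]
    unfold transmission at hu hw
    linarith
  rw [← add_sum_erase univ _ (mem_univ y), hy.slack_self] at htot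
  have hsub : insert x S ⊆ univ.erase y := by
    intro z hz
    rcases mem_insert.1 hz with rfl | hz
    · simpa using hx
    · exact mem_erase.2 ⟨fun e => hS (e ▸ hz), mem_univ _⟩
  have := sum_le_sum_of_subset_of_nonneg hsub
    (f := fun x => 2 * (G.dist y x : ℤ) - G.dist u x - G.dist w x)
    (fun z hz _ => hy.slack_nonneg hc (ne_of_mem_erase hz))
  rw [sum_insert hxS] at this
  have h1 := hy.slack_nonneg hc hx
  rw [hy.slack_eq hc hx] at this h1
  linarith

lemma mem_left_iff (hc : G.Connected) (hy : IsBivalent G y u w) (x : V) :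
    (x ≠ y ∧ G.dist y x = G.dist u x + 1) ↔ x ≠ y ∧ 0 ≤ (G.dist w x : ℤ) - G.dist u x := by
  refine and_congr_right fun hx => ?_
  rw [hy.dist_eq hc hx]
  omega

lemma mem_right_iff (hc : G.Connected) (hy : IsBivalent G y u w) (x : V) :
    (x ≠ y ∧ G.dist y x = G.dist w x + 1) ↔ x ≠ y ∧ (G.dist w x : ℤ) - G.dist u x ≤ 0 := by
  refine and_congr_right fun hx => ?_
  rw [hy.dist_eq hc hx]
  omega

end IsBivalent

lemma cast_card_eq_sum_ite (A : Finset V) : (A.card : ℤ) = ∑ x, if x ∈ A then 1 else 0 := by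
  simp

lemma sum_ite_single (a : V) (c : ℤ) : (∑ x : V, if x = a then c else 0) = c := by
  simp

lemma LowEnergy.exists_split (h : LowEnergy G) :
    ∃ y u w e e' ε A A', Split G y u w e e' ε A A' := by
  obtain ⟨y, u, w, hy, hu, hw⟩ := h.exists_flat_vertex
  have hc := h.conn
  obtain ⟨p, hp⟩ := h.exists_walk hy.adj_left.ne' hy.adj_right.ne'
  have hDsum : ∑ x, ((G.dist w x : ℤ) - G.dist u x) = 0 := by
    rw [sum_sub_distrib]; unfold transmission at hu hw; linarith
  have hDy : (G.dist w y : ℤ) - G.dist u y = 0 := by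
    rw [dist_eq_one_iff_adj.2 hy.adj_left.symm, dist_eq_one_iff_adj.2 hy.adj_right.symm]; simp
  have hlip := fun x x' (hx : G.Adj x x') => abs_dist_diff_le hc w u hx
  have hDu : 0 < (G.dist w u : ℤ) - G.dist u u := by
    have := hc.pos_dist_of_ne hy.ne.symm; simp; omega
  have hDw : (G.dist w w : ℤ) - G.dist u w < 0 := by
    have := hc.pos_dist_of_ne hy.ne; simp; omega
  set D : V → ℤ := fun x => (G.dist w x : ℤ) - G.dist u x with hD
  replace hDy : D y = 0 := hDy
  let A : Finset V := univ.filter fun x => x ≠ y ∧ G.dist y x = G.dist u x + 1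
  let A' : Finset V := univ.filter fun x => x ≠ y ∧ G.dist y x = G.dist w x + 1
  have hA1 : ∀ x, x ∈ A ↔ x ≠ y ∧ G.dist y x = G.dist u x + 1 := by simp [A]
  have hA1' : ∀ x, x ∈ A' ↔ x ≠ y ∧ G.dist y x = G.dist w x + 1 := by simp [A']
  have hA : ∀ x, x ∈ A ↔ x ≠ y ∧ 0 ≤ D x := fun x => by rw [hA1, hy.mem_left_iff hc]
  have hA' : ∀ x, x ∈ A' ↔ x ≠ y ∧ D x ≤ 0 := fun x => by rw [hA1', hy.mem_right_iff hc]
  have hcards : ∀ (e e' : V) (ε : ℕ), e ≠ y → e' ≠ y →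
      (∀ x, D x = 2 * (if x ∈ A then 1 else 0) - 2 * (if x ∈ A' then 1 else 0) -
        (if x = e then (ε : ℤ) else 0) + (if x = e' then (ε : ℤ) else 0)) →
      (∀ x, (if x ∈ A then 1 else 0) + (if x ∈ A' then 1 else 0) + (if x = y then 1 else 0) =
        1 + (if x = e then 1 - (ε : ℤ) else 0)) →
      A.card = A'.card ∧ Fintype.card V = 2 * A.card + ε := by
    intro e e' ε he he' h1 h2
    have h3 := sum_congr rfl fun x (_ : x ∈ univ) => h1 x
    rw [hDsum, sum_add_distrib, sum_sub_distrib, sum_sub_distrib, ← mul_sum, ← mul_sum,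
      ← cast_card_eq_sum_ite, ← cast_card_eq_sum_ite, sum_ite_single, sum_ite_single] at h3
    have h4 := sum_congr rfl fun x (_ : x ∈ univ) => h2 x
    rw [sum_add_distrib, sum_add_distrib, sum_add_distrib,
      ← cast_card_eq_sum_ite, ← cast_card_eq_sum_ite, sum_ite_single, sum_ite_single] at h4
    simp only [sum_const, card_univ, nsmul_eq_mul] at h4
    omega
  rcases IsBivalent.exists_balanced hc p with ⟨x, hx, h0⟩ | ⟨x, hx, x', hx', hxx, h1, h2⟩
  · have hxy : x ≠ y := fun e => hp (e ▸ hx)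
    have hother : ∀ z, z ≠ y → z ≠ x → |D z| = 2 := fun z hz hzx =>
      hy.eq_two_of_slack hc hu hw (S := {x}) (by simpa using hxy.symm)
        (by rw [sum_singleton, hy.slack_eq hc hxy, h0]; simp) hz (by simpa using hzx)
    change D x = 0 at h0
    obtain ⟨hc1, hc2⟩ := hcards x x 0 hxy hxy (fun z => by
        simp only [hA, hA']
        by_cases hz : z = y
        · simp [hz, hDy]
        by_cases hzx : z = x
        · subst hzx; simp [h0, hz]
        · rcases (abs_eq (by norm_num)).1 (hother z hz hzx) with h3 | h3 <;> simp [h3, hz])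
      (fun z => by
        simp only [hA, hA']
        by_cases hz : z = y
        · subst hz; simp [hxy.symm]
        by_cases hzx : z = x
        · subst hzx; simp [h0, hz]
        · rcases (abs_eq (by norm_num)).1 (hother z hz hzx) with h3 | h3 <;> simp [h3, hz, hzx])
    refine ⟨y, u, w, x, x, 0, A, A', hy, hA1, hA1', (hA x).2 ⟨hxy, h0.ge⟩, (hA' x).2 ⟨hxy, h0.le⟩,
      ?_, Or.inl ⟨rfl, rfl, ?_, ?_⟩, ?_, rfl, hc1, hc2⟩
    · intro z hz hz'
      rw [hA] at hz
      rw [hA'] at hz'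
      by_contra hzx
      have := hother z hz.1 (by tauto)
      rw [le_antisymm hz'.2 hz.2] at this
      simp at this
    · rintro rfl; exact hDu.ne' h0
    · rintro rfl; exact hDw.ne h0
    · intro z z' hz hz1 hz' hz1' hzz
      have := abs_le.1 (hlip z z' hzz)
      rw [hA] at hz hz1'
      rw [hA'] at hz' hz1
      exfalso
      have h3 : 0 < D z := by by_contra!; tauto
      have h4 : D z' < 0 := by by_contra!; tauto
      by_cases h5 : z = x
      · rw [h5] at h3; omega
      · rcases (abs_eq (by norm_num)).1 (hother z hz.1 h5) with h6 | h6 <;>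
        · simp only [hD] at *; omega
  · have hxy : x ≠ y := fun e => hp (e ▸ hx)
    have hxy' : x' ≠ y := fun e => hp (e ▸ hx')
    have hother : ∀ z, z ≠ y → z ≠ x → z ≠ x' → |D z| = 2 := fun z hz hzx hzx' =>
      hy.eq_two_of_slack hc hu hw (S := {x, x'}) (by simpa using ⟨hxy.symm, hxy'.symm⟩)
        (by rw [sum_pair hxx.ne, hy.slack_eq hc hxy, hy.slack_eq hc hxy', h1, h2]; norm_num)
        hz (by simpa using ⟨hzx, hzx'⟩)
    change D x = 1 at h1
    change D x' = -1 at h2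
    obtain ⟨hc1, hc2⟩ := hcards x x' 1 hxy hxy' (fun z => by
        simp only [hA, hA']
        by_cases hz : z = y
        · simp [hz, hDy, hxy.symm, hxy'.symm]
        by_cases hzx : z = x
        · subst hzx; simp [h1, hz, hxx.ne]
        by_cases hzx' : z = x'
        · subst hzx'; simp [h2, hz, hxx.ne']
        · rcases (abs_eq (by norm_num)).1 (hother z hz hzx hzx') with h3 | h3 <;>
            simp [h3, hz, hzx, hzx'])
      (fun z => by
        simp only [hA, hA']
        by_cases hz : z = y
        · subst hz; simp
        by_cases hzx : z = x
        · subst hzx; simp [h1, hz]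
        by_cases hzx' : z = x'
        · subst hzx'; simp [h2, hz]
        · rcases (abs_eq (by norm_num)).1 (hother z hz hzx hzx') with h3 | h3 <;> simp [h3, hz])
    refine ⟨y, u, w, x, x', 1, A, A', hy, hA1, hA1', (hA x).2 ⟨hxy, by omega⟩,
      (hA' x').2 ⟨hxy', by omega⟩, ?_, Or.inr ⟨rfl, hxx⟩, ?_, ?_, hc1, hc2⟩
    · intro z hz hz'
      rw [hA] at hz
      rw [hA'] at hz'
      have h0 := le_antisymm hz'.2 hz.2
      exfalso
      have := hother z hz.1 (by rintro rfl; omega) (by rintro rfl; omega)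
      rw [h0] at this
      simp at this
    · intro z z' hz hz1 hz' hz1' hzz
      have := abs_le.1 (hlip z z' hzz)
      rw [hA] at hz hz1'
      rw [hA'] at hz' hz1
      have h3 : 0 < D z := by by_contra!; tauto
      have h4 : D z' < 0 := by by_contra!; tauto
      change -2 ≤ D z - D z' ∧ D z - D z' ≤ 2 at this
      have h5 : D z = 1 := by omega
      have h6 : D z' = -1 := by omega
      constructor
      · by_contra h7
        have := hother z hz.1 h7 (by rintro rfl; omega)
        rw [h5] at this; simp at this
      · by_contra h7
        have := hother z' hz'.1 (by rintro rfl; omega) h7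
        rw [h6] at this; simp at this
    · have e1 := hy.dist_eq hc hxy
      have e2 := hy.dist_eq hc hxy'
      have e3 := dist_le_succ_of_adj hc hxx u
      have e4 := dist_le_succ_of_adj hc hxx w
      have e5 := dist_le_succ_of_adj hc hxx.symm u
      have e6 := dist_le_succ_of_adj hc hxx.symm w
      simp only [dist_comm (v := u), dist_comm (v := w)] at e3 e4 e5 e6
      simp only [hD] at h1 h2
      omega

end SplitExists

lemma dist_add_one_add_dist_le_of_mem_darts {V : Type*} {G : SimpleGraph V} {u v : V}
    (p : G.Walk u v) {d : G.Dart} (hd : d ∈ p.darts) :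
    G.dist u d.fst + 1 + G.dist d.snd v ≤ p.length := by
  induction p with
  | nil => simp at hd
  | @cons a b c hab p ih =>
    rcases List.mem_cons.1 hd with rfl | hd
    · have := dist_le p
      simp only [SimpleGraph.dist_self, Walk.length_cons]
      omega
    · have h1 := ih hd
      have h2 : G.dist a d.fst ≤ G.dist b d.fst + 1 := by
        by_cases hr : G.Reachable b d.fst
        · obtain ⟨q, hq⟩ := hr.exists_walk_length_eq_dist
          rw [← hq]
          exact dist_le (Walk.cons hab q)
        · have : ¬ G.Reachable a d.fst := fun h => hr (hab.symm.reachable.trans h)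
          rw [dist_eq_zero_of_not_reachable this]
          omega
      rw [Walk.length_cons]
      omega

/-- The excess, in the part `A`, of the degree of a vertex over `2`, where the connections of `A`
to the outside at `u` and at `e` are counted as edges. -/
noncomputable def excess {V : Type*} [Fintype V] (G : SimpleGraph V) (A : Finset V) (u e x : V) :
    ℤ :=
  (A.filter (G.Adj x)).card + (if x = u then 1 else 0) + (if x = e then 1 else 0) - 2

namespace Split

variable {V : Type*} [Fintype V] {G : SimpleGraph V} {y u w e e' : V} {ε : ℕ} {A A' : Finset V}

lemma symm (h : Split G y u w e e' ε A A') : Split G y w u e' e ε A' A where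
  bivalent := h.bivalent.symm
  mem_left := h.mem_right
  mem_right := h.mem_left
  left_mem := h.right_mem
  right_mem := h.left_mem
  inter x h1 h2 := by have := h.inter x h2 h1; tauto
  kind := by
    rcases h.kind with ⟨h1, h2, h3, h4⟩ | ⟨h1, h2⟩
    · exact Or.inl ⟨h1, h2.symm, h2 ▸ h4, h2 ▸ h3⟩
    · exact Or.inr ⟨h1, h2.symm⟩
  cross x x' h1 h2 h3 h4 h5 := (h.cross x' x h3 h4 h1 h2 h5.symm).symm
  dist_eq := h.dist_eq.symm
  card_eq := h.card_eq.symm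
  card := h.card_eq ▸ h.card

lemma notMem_left (h : Split G y u w e e' ε A A') : y ∉ A := fun hy =>
  ((h.mem_left y).1 hy).1 rfl

lemma ne_of_mem (h : Split G y u w e e' ε A A') {x : V} (hx : x ∈ A) : x ≠ y :=
  ((h.mem_left x).1 hx).1

lemma dist_left (h : Split G y u w e e' ε A A') {x : V} (hx : x ∈ A) :
    G.dist y x = G.dist u x + 1 := ((h.mem_left x).1 hx).2

lemma left_start_mem (h : Split G y u w e e' ε A A') : u ∈ A :=
  (h.mem_left u).2 ⟨h.bivalent.adj_left.ne', by
    rw [dist_eq_one_iff_adj.2 h.bivalent.adj_left]; simp⟩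

lemma cover (hc : G.Connected) (h : Split G y u w e e' ε A A') {x : V} (hy : x ≠ y)
    (hx : x ∉ A) : x ∈ A' := by
  have := h.bivalent.dist_eq hc hy
  rw [h.mem_left] at hx
  rw [h.mem_right]
  refine ⟨hy, ?_⟩
  by_contra h2
  exact hx ⟨hy, by omega⟩

lemma right_start_notMem (h : Split G y u w e e' ε A A') : w ∉ A := by
  intro hw
  have h1 := h.inter w hw h.symm.left_start_mem
  rcases h.kind with h2 | h2
  · exact h2.2.2.2 h1.1.symm
  · omega

/-- Every vertex of `A` other than `u` has a neighbour in `A` that is closer to `u`. -/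
lemma exists_parent (hc : G.Connected) (h : Split G y u w e e' ε A A') {x : V} (hx : x ∈ A)
    (hxu : x ≠ u) : ∃ r ∈ A, G.Adj x r ∧ G.dist u x = G.dist u r + 1 := by
  obtain ⟨r, hr, hd⟩ := exists_closer_neighbor hc hxu
  rw [dist_comm, dist_comm (u := r)] at hd
  have h1 := h.dist_left hx
  have h2 := dist_le_succ_of_adj hc hr y
  have h3 := dist_le_succ_of_adj hc h.bivalent.adj_left r
  simp only [dist_comm (v := y)] at h2
  refine ⟨r, (h.mem_left r).2 ⟨?_, by omega⟩, hr, hd⟩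
  rintro rfl
  rw [SimpleGraph.dist_self] at h2
  omega

lemma exists_walk_left (hc : G.Connected) (h : Split G y u w e e' ε A A') {x : V} (hx : x ∈ A) :
    ∃ p : G.Walk u x, p.length = G.dist u x ∧ ∀ z ∈ p.support, z ∈ A := by
  induction hk : G.dist u x generalizing x with
  | zero =>
    have := (hc.dist_eq_zero_iff).1 hk
    subst this
    exact ⟨Walk.nil, rfl, by simpa using hx⟩
  | succ k ih =>
    obtain ⟨r, hr, hxr, hd⟩ := h.exists_parent hc hx (by rintro rfl; simp at hk)
    obtain ⟨p, hp, hpA⟩ := ih hr (by omega)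
    refine ⟨p.concat hxr.symm, by simp [hp], fun z hz => ?_⟩
    rw [Walk.support_concat, List.mem_append] at hz
    rcases hz with hz | hz
    · exact hpA z hz
    · rw [List.mem_singleton.1 hz]; exact hx

lemma exists_dist_eq (hc : G.Connected) (h : Split G y u w e e' ε A A') {x : V} (hx : x ∈ A)
    {k : ℕ} (hk : k ≤ G.dist u x) : ∃ z ∈ A, G.dist u z = k := by
  induction hd : G.dist u x - k generalizing x with
  | zero => exact ⟨x, hx, by omega⟩
  | succ m ih =>
    obtain ⟨r, hr, -, hd'⟩ := h.exists_parent hc hx (by rintro rfl; simp at hd)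
    exact ih hr (by omega) (by omega)

lemma dist_cross (hc : G.Connected) (h : Split G y u w e e' ε A A') {x r : V} (hx : x ∈ A')
    (hr : r ∈ A) : G.dist x r = G.dist x y + G.dist y r ∨
      G.dist x r = G.dist x e' + ε + G.dist e r := by
  have h1 := hc.dist_triangle (u := x) (v := y) (w := r)
  have h2 : G.dist x r ≤ G.dist x e' + ε + G.dist e r := by
    have := hc.dist_triangle (u := x) (v := e') (w := r)
    rcases h.kind with ⟨h3, h4, -⟩ | ⟨h3, h4⟩
    · rw [h4]; rw [h4] at *; omega
    · have := dist_le_succ_of_adj hc h4.symm r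
      omega
  by_cases hr' : r ∈ A'
  · obtain ⟨h3, h4, h5⟩ := h.inter r hr hr'
    right; subst h3 h4 h5; simp
  obtain ⟨p, hp⟩ := hc.exists_walk_length_eq_dist x r
  obtain ⟨d, hd, hf, hs⟩ := p.exists_boundary_dart (A' : Set V) (by simpa) (by simpa)
  simp only [mem_coe] at hf hs
  by_cases hy : d.snd = y
  · left
    have := dist_add_dist_le_of_mem_support p (p.dart_snd_mem_support_of_mem_darts hd)
    rw [hy] at this
    omega
  right
  have hsA := h.symm.cover hc hy hs
  by_cases hfA : d.fst ∈ A
  · obtain ⟨h3, h4, h5⟩ := h.inter _ hfA hf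
    have := dist_add_dist_le_of_mem_support p (p.dart_fst_mem_support_of_mem_darts hd)
    rw [← h3, ← h4]
    rw [← h4, ← h3] at h2
    omega
  · obtain ⟨h3, h4⟩ := h.cross _ _ hsA hs hf hfA d.adj.symm
    have := dist_add_one_add_dist_le_of_mem_darts p hd
    rw [h3, h4] at this
    have : ε = 1 := by
      rcases h.kind with h5 | h5
      · rw [← h5.2.1, ← h3] at h4
        exact absurd h4 d.adj.ne
      · exact h5.1
    omega

lemma ite_adj_eq (hc : G.Connected) (h : Split G y u w e e' ε A A') {x : V} (hx : x ≠ y) (r : V) :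
    (if G.Adj x r then 1 else 0 : ℤ) =
      (if x ∈ A then if r ∈ A ∧ G.Adj x r then 1 else 0 else 0) +
      (if x ∈ A' then if r ∈ A' ∧ G.Adj x r then 1 else 0 else 0) +
      (if r = y then (if x = u then 1 else 0) + (if x = w then 1 else 0) else 0) +
      (if r = e' then if x = e then (ε : ℤ) else 0 else 0) +
      (if r = e then if x = e' then (ε : ℤ) else 0 else 0) := by
  by_cases hr : r = y
  · subst hr
    have h1 : r ∉ A := h.notMem_left
    have h2 : r ∉ A' := h.symm.notMem_left
    have h3 : r ≠ e := fun e1 => h1 (e1 ▸ h.left_mem)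
    have h4 : r ≠ e' := fun e1 => h2 (e1 ▸ h.right_mem)
    have h5 := h.bivalent.adj_iff x
    have h6 := h.bivalent.ne
    rw [adj_comm] at h5
    simp only [h5, h1, h2, h3, h4, false_and, if_false, ite_self, add_zero, zero_add, if_true]
    by_cases h7 : x = u
    · subst h7; simp [h6]
    · simp [h7]
  have hbothr := h.inter r
  have hbothx := h.inter x
  have hxc := h.cover hc hx
  have hrc := h.cover hc hr
  have heA := h.left_mem
  have heA' := h.right_mem
  rcases h.kind with ⟨h1, h2, -⟩ | ⟨h1, h2⟩
  · subst h1 h2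
    simp only [hr, if_false, Nat.cast_zero, ite_self, add_zero]
    by_cases ha : G.Adj x r
    · have hcr1 := h.cross x r
      have hcr2 := h.cross r x
      have := ha.ne
      by_cases x ∈ A <;> by_cases x ∈ A' <;> by_cases r ∈ A <;> by_cases r ∈ A' <;>
        simp_all [ha.symm]
    · simp [ha]
  · have hcr1 := h.cross x r
    have hcr2 := h.cross r x
    subst h1
    have heA2 : e ∉ A' := fun h3 => by simpa using (h.inter e heA h3).2.2
    have heA3 : e' ∉ A := fun h3 => by simpa using (h.inter e' h3 heA').2.2
    simp only [one_ne_zero, and_false, imp_false] at hbothr hbothx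
    by_cases ha : G.Adj x r
    · have ha' := ha.symm
      by_cases h3 : x ∈ A <;> by_cases h4 : r ∈ A
      · have h5 : x ≠ e' := by rintro rfl; exact heA3 h3
        have h6 : r ≠ e' := by rintro rfl; exact heA3 h4
        simp [h3, h4, ha, h5, h6, hbothx h3, hr]
      · obtain ⟨rfl, rfl⟩ := hcr1 h3 (hbothx h3) (hrc h4) h4 ha
        simp [h3, h4, ha, hbothx h3, hr, ha.ne']
      · obtain ⟨rfl, rfl⟩ := hcr2 h4 (hbothr h4) (hxc h3) h3 ha'
        simp [h3, ha, hbothr h4, hr, ha.ne]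
      · have h5 : x ≠ e := by rintro rfl; exact h3 heA
        have h6 : r ≠ e := by rintro rfl; exact h4 heA
        simp [h3, ha, h5, h6, hxc h3, hrc h4, hr]
    · have h5 : ¬ (r = e' ∧ x = e) := by rintro ⟨rfl, rfl⟩; exact ha h2
      have h6 : ¬ (r = e ∧ x = e') := by rintro ⟨rfl, rfl⟩; exact ha h2.symm
      simp only [ha, and_false, if_false, hr, ite_self, ← ite_and, h5, h6, add_zero]

lemma degree_eq (hc : G.Connected) (h : Split G y u w e e' ε A A') {x : V} (hx : x ≠ y) :
    (G.degree x : ℤ) = (if x ∈ A then ((A.filter (G.Adj x)).card : ℤ) else 0) +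
      (if x ∈ A' then ((A'.filter (G.Adj x)).card : ℤ) else 0) +
      (if x = u then 1 else 0) + (if x = w then 1 else 0) + (if x = e then (ε : ℤ) else 0) +
      (if x = e' then (ε : ℤ) else 0) := by
  have hcard : ∀ S : Finset V, ((S.filter (G.Adj x)).card : ℤ) =
      ∑ r, if r ∈ S ∧ G.Adj x r then 1 else 0 := by
    intro S
    rw [sum_boole, ← filter_filter, filter_mem_eq_inter, univ_inter]
  have hdeg : (G.degree x : ℤ) = ∑ r, if G.Adj x r then 1 else 0 := by
    rw [← card_neighborFinset_eq_degree, neighborFinset_eq_filter, sum_boole]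
  rw [hdeg, sum_congr rfl fun r _ => h.ite_adj_eq hc hx r]
  simp only [sum_add_distrib, hcard]
  have : ∀ (P : Prop) [Decidable P] (f : V → ℤ),
      (∑ r, if P then f r else 0) = if P then ∑ r, f r else 0 := by
    intro P _ f; split_ifs <;> simp
  rw [this, this]
  simp only [sum_ite_eq', mem_univ, if_true]
  ring

end Split

namespace Split

variable {V : Type*} [Fintype V] {G : SimpleGraph V} {y u w e e' : V} {ε : ℕ} {A A' : Finset V}

lemma excess_nonneg (hG : LowEnergy G) (h : Split G y u w e e' ε A A') {x : V} (hx : x ∈ A) :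
    0 ≤ excess G A u e x := by
  have hdeg := h.degree_eq hG.conn (h.ne_of_mem hx)
  have h2 := hG.two_le_degree x
  have hxw : x ≠ w := by rintro rfl; exact h.right_start_notMem hx
  have hxi := h.inter x hx
  unfold excess
  by_cases hxe : x = e
  · subst hxe
    rcases h.kind with ⟨h3, h4, h5, -⟩ | ⟨h3, h4⟩
    · obtain ⟨r, hr, hxr, -⟩ := h.exists_parent hG.conn hx h5
      have : 0 < (A.filter (G.Adj x)).card := card_pos.2 ⟨r, by simp [hr, hxr]⟩
      simp [h5]
      omega
    · have hx' : x ∉ A' := fun h6 => by have := hxi h6; omega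
      simp only [hx, hx', hxw, h4.ne, if_true, if_false, h3] at hdeg
      simp only [if_true]
      push_cast at hdeg
      linarith
  · have hx' : x ∉ A' := fun h6 => hxe (hxi h6).1
    have hxe' : x ≠ e' := by rintro rfl; exact hx' h.right_mem
    simp only [hx, hx', hxw, hxe, hxe', if_true, if_false] at hdeg
    simp only [hxe, if_false]
    linarith

lemma sum_excess (h : Split G y u w e e' ε A A') :
    ∑ x ∈ A, excess G A u e x =
      ∑ x ∈ A, ((A.filter (G.Adj x)).card : ℤ) + 2 - 2 * A.card := by
  unfold excess
  simp only [sum_sub_distrib, sum_add_distrib, sum_ite_eq', h.left_start_mem, h.left_mem, if_true,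
    sum_const, nsmul_eq_mul]
  ring

lemma sum_excess_add_sum_excess (hG : LowEnergy G) (h : Split G y u w e e' ε A A') :
    ∑ x ∈ A, excess G A u e x + ∑ x ∈ A', excess G A' w e' x = 4 := by
  rw [h.sum_excess, h.symm.sum_excess]
  have h1 := hG.sum_degree
  have hy : (G.degree y : ℤ) = 2 := by
    rw [← card_neighborFinset_eq_degree, LowEnergy.neighborFinset_eq h.bivalent,
      card_pair h.bivalent.ne]; rfl
  have hA : ∀ S : Finset V, y ∉ S → univ.erase y ∩ S = S := by
    intro S hS
    rw [erase_inter, univ_inter, erase_eq_of_notMem hS]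
  have he : e ∈ univ.erase y := by simpa using h.ne_of_mem h.left_mem
  have he' : e' ∈ univ.erase y := by simpa using h.symm.ne_of_mem h.right_mem
  have hu : u ∈ univ.erase y := by simpa using h.bivalent.adj_left.ne'
  have hw : w ∈ univ.erase y := by simpa using h.bivalent.adj_right.ne'
  rw [← add_sum_erase _ _ (mem_univ y), hy,
    sum_congr rfl fun x hx => h.degree_eq hG.conn (ne_of_mem_erase hx)] at h1
  simp only [sum_add_distrib, sum_ite_mem, sum_ite_eq', he, he', hu, hw, if_true,
    hA A h.notMem_left, hA A' h.symm.notMem_left] at h1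
  have h2 := h.card
  have h3 := h.card_eq
  zify at h2 h3
  linarith

/-- The subgraph of `G` induced on a finset of vertices. -/
abbrev inside (G : SimpleGraph V) (A : Finset V) : SimpleGraph A := G.comap Subtype.val

lemma sum_card_filter_adj (G : SimpleGraph V) (A : Finset V) :
    ∑ x ∈ A, ((A.filter (G.Adj x)).card : ℤ) = 2 * ((inside G A).edgeFinset.card : ℤ) := by
  have h1 := (inside G A).sum_degrees_eq_twice_card_edges
  have h2 : ∀ x : A, (inside G A).degree x = (A.filter (G.Adj x)).card := by
    intro x
    rw [← card_neighborFinset_eq_degree, ← card_map (Function.Embedding.subtype _)]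
    congr 1
    ext z
    simp [and_comm]
  rw [← sum_coe_sort]
  simp only [h2] at h1
  exact_mod_cast h1

lemma card_inside_edgeFinset (h : Split G y u w e e' ε A A')
    (hs : ∑ x ∈ A, excess G A u e x = 2) : (inside G A).edgeFinset.card = A.card := by
  rw [h.sum_excess, sum_card_filter_adj] at hs
  omega

lemma even_sum_excess (h : Split G y u w e e' ε A A') : Even (∑ x ∈ A, excess G A u e x) := by
  rw [h.sum_excess, sum_card_filter_adj]
  exact ⟨(inside G A).edgeFinset.card + 1 - A.card, by ring⟩

/-- If every excess vanishes, then `A` has a single vertex at each distance from `u`. -/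
lemma dist_injOn (hc : G.Connected) (h : Split G y u w e e' ε A A')
    (h0 : ∀ x ∈ A, excess G A u e x = 0) : Set.InjOn (G.dist u) (A : Set V) := by
  have key : ∀ k, ∀ x ∈ A, ∀ z ∈ A, G.dist u x = k → G.dist u z = k → x = z := by
    intro k
    induction k with
    | zero =>
      intro x _ z _ hx hz
      rw [hc.dist_eq_zero_iff] at hx hz
      exact hx.symm.trans hz
    | succ k ih =>
      intro x hx z hz hxk hzk
      by_contra hne
      obtain ⟨r, hr, hxr, hd⟩ := h.exists_parent hc hx (by rintro rfl; simp at hxk)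
      obtain ⟨r', hr', hzr, hd'⟩ := h.exists_parent hc hz (by rintro rfl; simp at hzk)
      obtain rfl := ih r hr r' hr' (by omega) (by omega)
      have h1 := h0 r hr
      unfold excess at h1
      by_cases hru : r = u
      · have h2 : ({x, z} : Finset V) ⊆ A.filter (G.Adj r) := by
          intro a ha
          rcases mem_insert.1 ha with rfl | ha
          · simp [hx, hxr.symm]
          · rw [mem_singleton.1 ha]; simp [hz, hzr.symm]
        have h3 := card_le_card h2
        rw [card_pair hne] at h3
        split_ifs at h1 <;> omega
      · obtain ⟨s, hs, hrs, hds⟩ := h.exists_parent hc hr hru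
        have h2 : ({s, x, z} : Finset V) ⊆ A.filter (G.Adj r) := by
          intro a ha
          simp only [mem_insert, mem_singleton] at ha
          rcases ha with rfl | rfl | rfl
          · simp [hs, hrs]
          · simp [hx, hxr.symm]
          · simp [hz, hzr.symm]
        have h3 := card_le_card h2
        have hsx : s ≠ x := by rintro rfl; omega
        have hsz : s ≠ z := by rintro rfl; omega
        rw [card_insert_of_notMem (by simp [hsx, hsz]), card_pair hne] at h3
        split_ifs at h1 <;> omega
  exact fun x hx z hz hxz => key _ x hx z hz rfl hxz.symm

lemma dist_le_of_excess_eq_zero (hc : G.Connected) (h : Split G y u w e e' ε A A')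
    (h0 : ∀ x ∈ A, excess G A u e x = 0) {x : V} (hx : x ∈ A) : G.dist u x ≤ G.dist u e := by
  by_contra! hlt
  obtain ⟨z, hz, hzd⟩ := h.exists_dist_eq hc hx hlt
  obtain ⟨r, hr, hzr, hd⟩ := h.exists_parent hc hz (by rintro rfl; simp at hzd)
  obtain rfl := h.dist_injOn hc h0 hr h.left_mem (by omega)
  have h1 := h0 r hr
  unfold excess at h1
  simp only [if_true] at h1
  have hzm : z ∈ A.filter (G.Adj r) := by simp [hz, hzr.symm]
  by_cases hru : r = u
  · have := card_pos.2 ⟨z, hzm⟩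
    simp only [hru, if_true] at h1 this
    omega
  · obtain ⟨s, hs, hrs, hds⟩ := h.exists_parent hc hr hru
    have h3 := one_lt_card.2 ⟨z, hzm, s, by simp [hs, hrs], by rintro rfl; omega⟩
    split_ifs at h1
    omega

lemma card_le_of_excess_eq_zero (hc : G.Connected) (h : Split G y u w e e' ε A A')
    (h0 : ∀ x ∈ A, excess G A u e x = 0) : A.card ≤ G.dist u e + 1 := by
  rw [← card_image_of_injOn (h.dist_injOn hc h0), ← card_range (G.dist u e + 1)]
  refine card_le_card (image_subset_iff.2 fun x hx => mem_range.2 ?_)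
  exact Nat.lt_succ_of_le (h.dist_le_of_excess_eq_zero hc h0 hx)

lemma excess_nonpos_of_card_le (hc : G.Connected) (h : Split G y u w e e' ε A A')
    (hcard : A.card ≤ G.dist u e + 1) {x : V} (hx : x ∈ A) : excess G A u e x ≤ 0 := by
  have hsub : range (G.dist u e + 1) ⊆ A.image (G.dist u) := by
    intro k hk
    obtain ⟨z, hz, hzk⟩ := h.exists_dist_eq hc h.left_mem (Nat.lt_succ_iff.1 (mem_range.1 hk))
    exact mem_image.2 ⟨z, hz, hzk⟩
  have h1 := card_le_card hsub
  rw [card_range] at h1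
  have h2 := card_image_le (s := A) (f := G.dist u)
  have hinj : Set.InjOn (G.dist u) (A : Set V) := card_image_iff.1 (by omega)
  have himg := eq_of_subset_of_card_le hsub (by rw [card_range]; omega)
  have hlt : ∀ z ∈ A, G.dist u z ≤ G.dist u e := fun z hz =>
    Nat.lt_succ_iff.1 (mem_range.1 (himg ▸ mem_image_of_mem _ hz))
  have hbound : ∀ T : Finset ℕ, (∀ z ∈ A, G.Adj x z → G.dist u z ∈ T) →
      (A.filter (G.Adj x)).card ≤ T.card := fun T hT =>
    card_le_card_of_injOn (G.dist u)
      (fun z hz => by simp only [coe_filter, Set.mem_ofPred_eq] at hz; exact hT z hz.1 hz.2)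
      (hinj.mono (by intro z hz; simp only [coe_filter, Set.mem_ofPred_eq] at hz; exact hz.1))
  have hstep : ∀ z ∈ A, G.Adj x z → G.dist u z + 1 = G.dist u x ∨ G.dist u z = G.dist u x + 1 := by
    intro z hz hxz
    have h3 := dist_le_succ_of_adj hc hxz u
    have h4 := dist_le_succ_of_adj hc hxz.symm u
    simp only [dist_comm (v := u)] at h3 h4
    have h5 : G.dist u z ≠ G.dist u x := fun h5 => hxz.ne (hinj hx hz h5.symm)
    omega
  have hxu0 : x = u → G.dist u x = 0 := by rintro rfl; simp
  have hxe0 : x = e → G.dist u x = G.dist u e := by rintro rfl; rfl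
  unfold excess
  by_cases hxu : x = u
  · have := hxu0 hxu
    by_cases hxe : x = e
    · have := hxe0 hxe
      have h6 := hbound ∅ fun z hz hxz => by
        have := hstep z hz hxz
        have := hlt z hz
        omega
      rw [card_empty] at h6
      rw [if_pos hxu, if_pos hxe]
      omega
    · have h6 := hbound {1} fun z hz hxz => by
        have := hstep z hz hxz
        rw [mem_singleton]
        omega
      rw [card_singleton] at h6
      rw [if_pos hxu, if_neg hxe]
      omega
  · by_cases hxe : x = e
    · have := hxe0 hxe
      have h6 := hbound {G.dist u x - 1} fun z hz hxz => by
        have := hstep z hz hxz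
        have := hlt z hz
        rw [mem_singleton]
        omega
      rw [card_singleton] at h6
      rw [if_neg hxu, if_pos hxe]
      omega
    · have h6 := hbound {G.dist u x - 1, G.dist u x + 1} fun z hz hxz => by
        have := hstep z hz hxz
        rw [mem_insert, mem_singleton]
        omega
      have h7 := card_le_two (a := G.dist u x - 1) (b := G.dist u x + 1)
      rw [if_neg hxu, if_neg hxe]
      omega

lemma sum_excess_ne_zero (hG : LowEnergy G) (h : Split G y u w e e' ε A A') :
    ∑ x ∈ A, excess G A u e x ≠ 0 := by
  intro h0
  have hc := hG.conn
  have h1 := (sum_eq_zero_iff_of_nonneg fun x hx => h.excess_nonneg hG hx).1 h0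
  have h2 := h.card_le_of_excess_eq_zero hc h1
  have h3 := h.dist_left h.left_mem
  have h4 := h.symm.dist_left h.right_mem
  have h5 := h.dist_eq
  have h6 : ∑ x ∈ A', excess G A' w e' x ≤ 0 :=
    sum_nonpos fun x hx => h.symm.excess_nonpos_of_card_le hc (by rw [← h.card_eq]; omega) hx
  have := h.sum_excess_add_sum_excess hG
  omega

lemma sum_excess_eq_two (hG : LowEnergy G) (h : Split G y u w e e' ε A A') :
    ∑ x ∈ A, excess G A u e x = 2 := by
  have h1 := h.sum_excess_ne_zero hG
  have h2 := h.symm.sum_excess_ne_zero hG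
  have h3 := h.sum_excess_add_sum_excess hG
  have h4 := sum_nonneg fun x hx => h.excess_nonneg hG (x := x) hx
  have h5 := sum_nonneg fun x hx => h.symm.excess_nonneg hG (x := x) hx
  obtain ⟨k, hk⟩ := h.even_sum_excess
  obtain ⟨k', hk'⟩ := h.symm.even_sum_excess
  omega

lemma exists_cycle (hG : LowEnergy G) (h : Split G y u w e e' ε A A') :
    ∃ (v : V) (c : G.Walk v v), c.IsCycle ∧ ∀ x ∈ c.support, x ∈ A := by
  have hu := h.left_start_mem
  have hconn : (inside G A).Connected := by
    have hreach : ∀ x (hx : x ∈ A), (inside G A).Reachable ⟨u, hu⟩ ⟨x, hx⟩ := by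
      intro x hx
      induction hk : G.dist u x using Nat.strong_induction_on generalizing x with
      | _ k ih =>
        by_cases hxu : x = u
        · subst hxu; exact Reachable.refl _
        · obtain ⟨r, hr, hxr, hd⟩ := h.exists_parent hG.conn hx hxu
          exact (ih _ (by omega) r hr rfl).trans (Adj.reachable hxr.symm)
    have : Nonempty A := ⟨⟨u, hu⟩⟩
    exact ⟨fun a b => (hreach a a.2).symm.trans (hreach b b.2)⟩
  have hacyc : ¬ (inside G A).IsAcyclic := by
    intro hac
    have h1 := IsTree.card_edgeFinset ⟨hconn, hac⟩
    have h2 := h.card_inside_edgeFinset (h.sum_excess_eq_two hG)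
    simp only [Fintype.card_coe] at h1
    omega
  simp only [IsAcyclic, not_forall, not_not] at hacyc
  obtain ⟨v, c, hcyc⟩ := hacyc
  let φ : inside G A ↪g G := Embedding.comap (Function.Embedding.subtype _) G
  refine ⟨φ v, c.map φ.toHom, hcyc.map φ.injective, fun x hx => ?_⟩
  rw [Walk.support_map, List.mem_map] at hx
  obtain ⟨z, -, rfl⟩ := hx
  exact z.2

end Split

lemma exists_walk_prefix {V : Type*} {G : SimpleGraph V} {a b : V} (p : G.Walk a b) (S : Set V)
    (ha : a ∈ S) (hb : b ∉ S) : ∃ c d, c ∈ S ∧ d ∉ S ∧ d ∈ p.support ∧ G.Adj c d ∧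
      ∃ q : G.Walk a c, ∀ x ∈ q.support, x ∈ S := by
  induction p with
  | nil => exact absurd ha hb
  | @cons a r b har p ih =>
    by_cases hr : r ∈ S
    · obtain ⟨c, d, hc, hd, hdp, hcd, q, hq⟩ := ih hr hb
      refine ⟨c, d, hc, hd, by simp [hdp], hcd, Walk.cons har q, fun x hx => ?_⟩
      rw [Walk.support_cons, List.mem_cons] at hx
      rcases hx with rfl | hx
      · exact ha
      · exact hq x hx
    · exact ⟨a, r, ha, hr, by simp, har, Walk.nil, by simpa using ha⟩

/-- A path `b 0, …, b k` from `p` to `q` whose inner vertices are bivalent in `G`. -/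
structure IsArc {V : Type*} (G : SimpleGraph V) (p q : V) (k : ℕ) (b : ℕ → V) : Prop where
  pos : 0 < k
  start : b 0 = p
  finish : b k = q
  adj : ∀ i < k, G.Adj (b i) (b (i + 1))
  bivalent : ∀ i, 0 < i → i < k → IsBivalent G (b i) (b (i - 1)) (b (i + 1))
  inj : ∀ i j, i ≤ k → j ≤ k → b i = b j → i = j

/-- Two internally disjoint arcs between `p` and `q`, forming a cycle inside `A`, such that `O` is
the set of vertices outside the cycle. -/
structure IsPocket {V : Type*} (G : SimpleGraph V) (A O : Finset V) (p q : V) (k k' : ℕ)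
    (b b' : ℕ → V) : Prop where
  arc : IsArc G p q k b
  arc' : IsArc G p q k' b'
  disj : ∀ i j, 0 < i → i < k → 0 < j → j < k' → b i ≠ b' j
  mem_iff : ∀ x, x ∈ O ↔ (∀ i ≤ k, x ≠ b i) ∧ ∀ j ≤ k', x ≠ b' j
  mem_left : ∀ i ≤ k, b i ∈ A
  mem_right : ∀ j ≤ k', b' j ∈ A
  three_le : 3 ≤ k + k'

namespace Split

variable {V : Type*} [Fintype V] {G : SimpleGraph V} {y u w e e' : V} {ε : ℕ} {A A' : Finset V}

lemma exists_pair_of_mem_cycle {v z : V} {c : G.Walk v v} (hc : c.IsCycle) (hz : z ∈ c.support) :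
    ∃ r s, r ≠ s ∧ r ∈ c.support ∧ s ∈ c.support ∧ G.Adj z r ∧ G.Adj z s := by
  have hc' : (c.rotate z hz).IsCycle := (Walk.isCycle_rotate hz).2 hc
  refine ⟨(c.rotate z hz).snd, (c.rotate z hz).penultimate, hc'.snd_ne_penultimate, ?_, ?_,
    Walk.adj_snd hc'.not_nil, (Walk.adj_penultimate hc'.not_nil).symm⟩
  · rw [← Walk.mem_support_rotate_iff c z hz]; exact Walk.getVert_mem_support _ _
  · rw [← Walk.mem_support_rotate_iff c z hz]; exact Walk.getVert_mem_support _ _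

lemma excess_pos_of_cycle (hG : LowEnergy G) (h : Split G y u w e e' ε A A') {v z r : V}
    {c : G.Walk v v} (hc : c.IsCycle) (hcA : ∀ x ∈ c.support, x ∈ A) (hz : z ∈ c.support)
    (hr : r ∉ c.support) (hzr : G.Adj z r) : 1 ≤ excess G A u e z := by
  obtain ⟨a, s, has, ha, hs, hza, hzs⟩ := exists_pair_of_mem_cycle hc hz
  have hzA := hcA z hz
  have h2 : ({a, s} : Finset V) ⊆ A.filter (G.Adj z) := by
    intro x hx
    rcases mem_insert.1 hx with rfl | hx
    · simp [hcA _ ha, hza]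
    · rw [mem_singleton.1 hx]; simp [hcA _ hs, hzs]
  have h3 := card_le_card h2
  rw [card_pair has] at h3
  unfold excess
  by_cases hrA : r ∈ A
  · have h4 : ({r, a, s} : Finset V) ⊆ A.filter (G.Adj z) :=
      insert_subset (by simp [hrA, hzr]) h2
    have h5 := card_le_card h4
    have hra : r ≠ a := by rintro rfl; exact hr ha
    have hrs : r ≠ s := by rintro rfl; exact hr hs
    rw [card_insert_of_notMem (by simp [hra, hrs]), card_pair has] at h5
    split_ifs <;> omega
  · have h4 : z = u ∨ z = e := by
      by_cases hry : r = y
      · subst hry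
        rcases (h.bivalent.adj_iff z).1 hzr.symm with h5 | h5
        · exact Or.inl h5
        · exact absurd (h5 ▸ hzA) h.right_start_notMem
      · right
        by_cases hzA' : z ∈ A'
        · exact (h.inter z hzA hzA').1
        · exact (h.cross z r hzA hzA' (h.cover hG.conn hry hrA) hrA hzr).1
    rcases h4 with h4 | h4
    · rw [if_pos h4]; split_ifs <;> omega
    · rw [if_pos h4]; split_ifs <;> omega

lemma exists_two_exits (hG : LowEnergy G) (h : Split G y u w e e' ε A A') {v : V}
    {c : G.Walk v v} (hc : c.IsCycle) (hcA : ∀ x ∈ c.support, x ∈ A) :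
    ∃ p q, p ≠ q ∧ p ∈ c.support ∧ q ∈ c.support ∧ 1 ≤ excess G A u e p ∧
      1 ≤ excess G A u e q := by
  have hy : y ∉ c.support := fun hy => h.notMem_left (hcA y hy)
  obtain ⟨W⟩ := hG.conn.preconnected v y
  obtain ⟨d, hd, h1, h2⟩ := W.exists_boundary_dart {x | x ∈ c.support} c.start_mem_support hy
  obtain ⟨a, s, has, ha, hs, hza, hzs⟩ := exists_pair_of_mem_cycle hc h1
  have hyp : y ≠ d.fst := fun e1 => hy (e1 ▸ h1)
  obtain ⟨W', hW'⟩ := hG.exists_walk hza.ne' hyp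
  obtain ⟨d', hd', h1', h2'⟩ := W'.exists_boundary_dart {x | x ∈ c.support} ha hy
  refine ⟨d.fst, d'.fst, fun e1 => hW' (e1 ▸ W'.dart_fst_mem_support_of_mem_darts hd'), h1, h1',
    h.excess_pos_of_cycle hG hc hcA h1 h2 d.adj, h.excess_pos_of_cycle hG hc hcA h1' h2' d'.adj⟩

lemma excess_nonpos_of_ne (hG : LowEnergy G) (h : Split G y u w e e' ε A A') {p q : V}
    (hpq : p ≠ q) (hp : p ∈ A) (hq : q ∈ A) (hp1 : 1 ≤ excess G A u e p)
    (hq1 : 1 ≤ excess G A u e q) {z : V} (hz : z ∈ A) (hzp : z ≠ p) (hzq : z ≠ q) :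
    excess G A u e z ≤ 0 := by
  have h1 := h.sum_excess_eq_two hG
  have h2 : ({z, p, q} : Finset V) ⊆ A := by
    intro x hx
    simp only [mem_insert, mem_singleton] at hx
    rcases hx with rfl | rfl | rfl <;> assumption
  have h3 := sum_le_sum_of_subset_of_nonneg h2 (f := excess G A u e)
    (fun x hx _ => h.excess_nonneg hG hx)
  rw [sum_insert (by simp [hzp, hzq]), sum_pair hpq] at h3
  omega

lemma exists_pocket (hG : LowEnergy G) (h : Split G y u w e e' ε A A') :
    ∃ O p q k k' b b', IsPocket G A O p q k k' b b' := by
  obtain ⟨v, c, hc, hcA⟩ := h.exists_cycle hG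
  obtain ⟨p, q, hpq, hp, hq, hp1, hq1⟩ := h.exists_two_exits hG hc hcA
  set g := c.rotate p hp with hg
  have hmem : ∀ x, x ∈ g.support ↔ x ∈ c.support := fun x => Walk.mem_support_rotate_iff c p hp
  have hgc : g.IsCycle := (Walk.isCycle_rotate hp).2 hc
  have hgA : ∀ i, g.getVert i ∈ A := fun i =>
    hcA _ ((hmem _).1 (Walk.getVert_mem_support _ _))
  obtain ⟨m, hmq, hml⟩ := Walk.mem_support_iff_exists_getVert.1 ((hmem q).2 hq)
  have hl := hgc.three_le_length
  have hm0 : 0 < m := by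
    by_contra! h0
    rw [Nat.le_zero.1 h0, Walk.getVert_zero] at hmq
    exact hpq hmq
  have hm1 : m < g.length := by
    refine lt_of_le_of_ne hml fun h0 => ?_
    rw [h0, Walk.getVert_length] at hmq
    exact hpq hmq
  have hinj : ∀ i j, 1 ≤ i → i ≤ g.length → 1 ≤ j → j ≤ g.length →
      g.getVert i = g.getVert j → i = j := fun i j h1 h2 h3 h4 h5 =>
    hgc.getVert_injOn ⟨h1, h2⟩ ⟨h3, h4⟩ h5
  have hinj' : ∀ i j, i < g.length → j < g.length →
      g.getVert i = g.getVert j → i = j := fun i j h1 h2 h5 =>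
    hgc.getVert_injOn' (by simp only [Set.mem_ofPred_eq]; omega)
      (by simp only [Set.mem_ofPred_eq]; omega) h5
  have hbiv : ∀ i, 0 < i → i < g.length → i ≠ m →
      IsBivalent G (g.getVert i) (g.getVert (i - 1)) (g.getVert (i + 1)) := by
    intro i hi hil him
    have hzc : g.getVert i ∈ c.support := (hmem _).1 (Walk.getVert_mem_support _ _)
    have hzp : g.getVert i ≠ p := by
      intro h1
      have := hinj' i 0 hil (by omega) (by rw [h1, Walk.getVert_zero])
      omega
    have hzq : g.getVert i ≠ q := by
      intro h1
      exact him (hinj' i m hil hm1 (by rw [h1, hmq]))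
    have h0 := h.excess_nonpos_of_ne hG hpq (hcA p hp) (hcA q hq) hp1 hq1 (hgA i) hzp hzq
    have hne := hgc.getVert_sub_one_ne_getVert_add_one hil.le
    have ha1 : G.Adj (g.getVert i) (g.getVert (i - 1)) := by
      have := g.adj_getVert_succ (i := i - 1) (by omega)
      rw [Nat.sub_add_cancel hi] at this
      exact this.symm
    have ha2 : G.Adj (g.getVert i) (g.getVert (i + 1)) := g.adj_getVert_succ hil
    have hsub : ({g.getVert (i - 1), g.getVert (i + 1)} : Finset V) ⊆
        A.filter (G.Adj (g.getVert i)) := by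
      intro x hx
      rcases mem_insert.1 hx with rfl | hx
      · simp [hgA, ha1]
      · rw [mem_singleton.1 hx]; simp [hgA, ha2]
    have heq := eq_of_subset_of_card_le hsub (by
      rw [card_pair hne]
      unfold excess at h0
      split_ifs at h0 <;> omega)
    refine ⟨hne, fun x => ⟨fun hx => ?_, ?_⟩⟩
    · have hxc : x ∈ c.support := by
        by_contra hxc
        have := h.excess_pos_of_cycle hG hc hcA hzc hxc hx
        omega
      have : x ∈ A.filter (G.Adj (g.getVert i)) := by simp [hcA x hxc, hx]
      rw [← heq] at this
      simpa using this
    · rintro (rfl | rfl)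
      · exact ha1
      · exact ha2
  refine ⟨univ.filter fun x => x ∉ c.support, p, q, m, g.length - m, g.getVert,
    fun i => g.getVert (g.length - i), ?_⟩
  refine ⟨⟨hm0, g.getVert_zero, hmq, fun i hi => g.adj_getVert_succ (by omega),
    fun i h0 h1 => hbiv i h0 (by omega) (by omega),
    fun i j h1 h2 h3 => hinj' i j (by omega) (by omega) h3⟩,
    ⟨by omega, by simp, ?_, ?_, ?_, ?_⟩, ?_, ?_, fun i _ => hgA i, fun i _ => hgA _, by omega⟩
  · simp only [Nat.sub_sub_self hml, hmq]
  · intro i hi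
    have := g.adj_getVert_succ (i := g.length - (i + 1)) (by omega)
    rw [show g.length - (i + 1) + 1 = g.length - i by omega] at this
    exact this.symm
  · intro i h0 h1
    have := (hbiv (g.length - i) (by omega) (by omega) (by omega)).symm
    rwa [show g.length - i + 1 = g.length - (i - 1) by omega,
      show g.length - i - 1 = g.length - (i + 1) by omega] at this
  · intro i j h1 h2 h3
    have := hinj _ _ (by omega) (by omega) (by omega) (by omega) h3
    omega
  · intro i j h1 h2 h3 h4 h5
    have := hinj _ _ (by omega) (by omega) (by omega) (by omega) h5
    omega
  · intro x
    simp only [mem_filter, mem_univ, true_and, ← hmem, Walk.mem_support_iff_exists_getVert]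
    constructor
    · intro hx
      exact ⟨fun i hi e1 => hx ⟨i, e1.symm, by omega⟩, fun i hi e1 => hx ⟨_, e1.symm, by omega⟩⟩
    · rintro ⟨h1, h2⟩ ⟨i, hi, hil⟩
      rcases le_total i m with him | him
      · exact h1 i him hi.symm
      · exact h2 (g.length - i) (by omega) (by rw [Nat.sub_sub_self hil]; exact hi.symm)

end Split

namespace IsArc

variable {V : Type*} [Fintype V] {G : SimpleGraph V} {p q : V} {k : ℕ} {b : ℕ → V}

lemma reverse (h : IsArc G p q k b) : IsArc G q p k fun i => b (k - i) where
  pos := h.pos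
  start := h.finish
  finish := by simp [h.start]
  adj i hi := by
    have := h.adj (k - (i + 1)) (by omega)
    rw [show k - (i + 1) + 1 = k - i by omega] at this
    exact this.symm
  bivalent i h0 h1 := by
    have := (h.bivalent (k - i) (by omega) (by omega)).symm
    rwa [show k - i + 1 = k - (i - 1) by omega, show k - i - 1 = k - (i + 1) by omega] at this
  inj i j hi hj hij := by
    have := h.inj (k - i) (k - j) (by omega) (by omega) hij
    omega

lemma ne (h : IsArc G p q k b) : p ≠ q := fun e1 => by
  have := h.inj 0 k (by omega) le_rfl (by rw [h.start, h.finish, e1])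
  have := h.pos
  omega

lemma exists_walk (h : IsArc G p q k b) {i j : ℕ} (hij : i ≤ j) (hj : j ≤ k) :
    ∃ W : G.Walk (b i) (b j), ∀ x ∈ W.support, ∃ m, i ≤ m ∧ m ≤ j ∧ x = b m := by
  induction j, hij using Nat.le_induction with
  | base => exact ⟨Walk.nil, fun x hx => ⟨i, le_rfl, le_rfl, by simpa using hx⟩⟩
  | succ j hij ih =>
    obtain ⟨W, hW⟩ := ih (by omega)
    refine ⟨W.concat (h.adj j (by omega)), fun x hx => ?_⟩
    rw [Walk.support_concat, List.mem_append, List.mem_singleton] at hx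
    rcases hx with hx | rfl
    · obtain ⟨m, h1, h2, h3⟩ := hW x hx
      exact ⟨m, h1, by omega, h3⟩
    · exact ⟨j + 1, by omega, le_rfl, rfl⟩

lemma dist_le_left (hc : G.Connected) (h : IsArc G p q k b) (x : V) {i : ℕ} (hi : i ≤ k) :
    G.dist (b i) x ≤ G.dist p x + i := by
  induction i with
  | zero => simp [h.start]
  | succ i ih =>
    have := dist_le_succ_of_adj hc (h.adj i hi).symm x
    have := ih (by omega)
    omega

lemma dist_le_right (hc : G.Connected) (h : IsArc G p q k b) (x : V) {i : ℕ} (hi : i ≤ k) :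
    G.dist (b i) x ≤ G.dist q x + (k - i) := by
  have := h.reverse.dist_le_left hc x (i := k - i) (by omega)
  rwa [Nat.sub_sub_self hi] at this

lemma dist_eq (hc : G.Connected) (h : IsArc G p q k b) {x : V}
    (hx : ∀ i, 0 < i → i < k → x ≠ b i) {i : ℕ} (hi : i ≤ k) :
    G.dist (b i) x = min (G.dist p x + i) (G.dist q x + (k - i)) := by
  refine le_antisymm (le_min (h.dist_le_left hc x hi) (h.dist_le_right hc x hi)) ?_
  induction hN : G.dist (b i) x using Nat.strong_induction_on generalizing i with
  | _ N ih =>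
    rcases Nat.eq_zero_or_pos i with rfl | h0
    · rw [h.start] at hN
      omega
    · rcases hi.eq_or_lt with rfl | h1
      · rw [h.finish] at hN
        omega
      · have h2 := (h.bivalent i h0 h1).dist_eq hc (hx i h0 h1)
        rcases le_total (G.dist (b (i - 1)) x) (G.dist (b (i + 1)) x) with h3 | h3
        · have := ih _ (by omega) (i := i - 1) (by omega) rfl
          omega
        · have := ih _ (by omega) (i := i + 1) (by omega) rfl
          omega

lemma dist_le (hc : G.Connected) (h : IsArc G p q k b) : G.dist p q ≤ k := by
  have := h.dist_le_left hc p h.pos.le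
  have := h.dist_le_left hc p (i := k) le_rfl
  rw [h.finish, dist_comm] at this
  simpa using this

end IsArc

lemma sum_Ico_second_difference (g : ℕ → ℤ) {k : ℕ} (hk : 1 ≤ k) :
    ∑ i ∈ Ico 1 k, (2 * g i - g (i - 1) - g (i + 1)) = g 1 - g 0 + (g (k - 1) - g k) := by
  induction k, hk using Nat.le_induction with
  | base => simp
  | succ k hk ih =>
    rw [sum_Ico_succ_top hk, ih]
    simp only [Nat.add_sub_cancel]
    ring

namespace IsPocket

variable {V : Type*} [Fintype V] {G : SimpleGraph V} {A O : Finset V} {p q : V} {k k' : ℕ}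
  {b b' : ℕ → V}

lemma swap (h : IsPocket G A O p q k k' b b') : IsPocket G A O p q k' k b' b where
  arc := h.arc'
  arc' := h.arc
  disj i j h1 h2 h3 h4 h5 := h.disj j i h3 h4 h1 h2 h5.symm
  mem_iff x := by rw [h.mem_iff, and_comm]
  mem_left := h.mem_right
  mem_right := h.mem_left
  three_le := by have := h.three_le; omega

lemma reverse (h : IsPocket G A O p q k k' b b') :
    IsPocket G A O q p k k' (fun i => b (k - i)) fun i => b' (k' - i) where
  arc := h.arc.reverse
  arc' := h.arc'.reverse
  disj i j _ _ _ _ := h.disj (k - i) (k' - j) (by omega) (by omega) (by omega) (by omega)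
  mem_iff x := by
    rw [h.mem_iff]
    refine and_congr ⟨fun h1 i _ => h1 _ (by omega), fun h1 i hi => ?_⟩
      ⟨fun h1 i _ => h1 _ (by omega), fun h1 i hi => ?_⟩
    · have := h1 (k - i) (by omega)
      rwa [Nat.sub_sub_self hi] at this
    · have := h1 (k' - i) (by omega)
      rwa [Nat.sub_sub_self hi] at this
  mem_left i _ := h.mem_left _ (by omega)
  mem_right i _ := h.mem_right _ (by omega)
  three_le := h.three_le

lemma exists_walk_cycle (h : IsPocket G A O p q k k' b b') {i : ℕ} (h0 : 0 < i) (h1 : i < k) :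
    ∃ W : G.Walk (b (i - 1)) (b (i + 1)), b i ∉ W.support ∧ ∀ x ∈ W.support, x ∉ O := by
  obtain ⟨W₁, hW₁⟩ := h.arc.exists_walk (i := 0) (j := i - 1) (by omega) (by omega)
  obtain ⟨W₂, hW₂⟩ := h.arc'.exists_walk (i := 0) (j := k') (by omega) le_rfl
  obtain ⟨W₃, hW₃⟩ := h.arc.exists_walk (i := i + 1) (j := k) (by omega) le_rfl
  refine ⟨(W₁.reverse.append (W₂.copy (h.arc'.start.trans h.arc.start.symm)
    (h.arc'.finish.trans h.arc.finish.symm))).append W₃.reverse, ?_, ?_⟩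
  · simp only [Walk.mem_support_append_iff, Walk.support_reverse, List.mem_reverse,
      Walk.support_copy]
    rintro ((hx | hx) | hx)
    · obtain ⟨m, h2, h3, h4⟩ := hW₁ _ hx
      have := h.arc.inj _ _ h1.le (by omega) h4
      omega
    · obtain ⟨m, h2, h3, h4⟩ := hW₂ _ hx
      rcases Nat.eq_zero_or_pos m with rfl | hm
      · rw [h.arc'.start, ← h.arc.start] at h4
        have := h.arc.inj _ _ h1.le (by omega) h4
        omega
      · rcases h3.eq_or_lt with rfl | hm'
        · rw [h.arc'.finish, ← h.arc.finish] at h4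
          have := h.arc.inj _ _ h1.le le_rfl h4
          omega
        · exact h.disj i m h0 h1 hm hm' h4
    · obtain ⟨m, h2, h3, h4⟩ := hW₃ _ hx
      have := h.arc.inj _ _ h1.le (by omega) h4
      omega
  · intro x hx hxO
    rw [h.mem_iff] at hxO
    simp only [Walk.mem_support_append_iff, Walk.support_reverse, List.mem_reverse,
      Walk.support_copy] at hx
    rcases hx with (hx | hx) | hx
    · obtain ⟨m, h2, h3, h4⟩ := hW₁ _ hx
      exact hxO.1 m (by omega) h4
    · obtain ⟨m, h2, h3, h4⟩ := hW₂ _ hx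
      exact hxO.2 m h3 h4
    · obtain ⟨m, h2, h3, h4⟩ := hW₃ _ hx
      exact hxO.1 m h3 h4

/-- The energy imbalance of the two end edges of an arc is bounded below by the contribution of
the vertices outside the pocket. -/
lemma sum_le (hc : G.Connected) (h : IsPocket G A O p q k k' b b') :
    ∑ x ∈ O, ((G.dist (b 1) x : ℤ) - G.dist p x + (G.dist (b (k - 1)) x - G.dist q x)) ≤
      transmission G (b 1) - transmission G p +
        (transmission G (b (k - 1)) - transmission G q) := by
  have h1 : ∀ i ∈ Ico 1 k, ∑ x ∈ O, (2 * (G.dist (b i) x : ℤ) - G.dist (b (i - 1)) x -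
      G.dist (b (i + 1)) x) ≤ 2 * transmission G (b i) - transmission G (b (i - 1)) -
        transmission G (b (i + 1)) := by
    intro i hi
    rw [mem_Ico] at hi
    obtain ⟨W, hW, hWO⟩ := h.exists_walk_cycle (i := i) (by omega) hi.2
    have h2 := (h.arc.bivalent i (by omega) hi.2).sum_slack_nonneg hc W hW (S := Oᶜ)
      (fun x hx => mem_compl.2 (hWO x hx))
      (mem_compl.2 fun hx => ((h.mem_iff _).1 hx).1 i hi.2.le rfl)
    have h3 := sum_add_sum_compl O fun x => (2 * (G.dist (b i) x : ℤ) - G.dist (b (i - 1)) x -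
      G.dist (b (i + 1)) x)
    have h4 : ∑ x, (2 * (G.dist (b i) x : ℤ) - G.dist (b (i - 1)) x - G.dist (b (i + 1)) x) =
        2 * transmission G (b i) - transmission G (b (i - 1)) - transmission G (b (i + 1)) := by
      rw [sum_sub_distrib, sum_sub_distrib, ← mul_sum]; rfl
    linarith
  have h2 := sum_le_sum h1
  rw [sum_Ico_second_difference (fun i => transmission G (b i)) h.arc.pos, sum_comm,
    sum_congr rfl fun x _ => sum_Ico_second_difference (fun i => (G.dist (b i) x : ℤ)) h.arc.pos]
    at h2
  simpa only [h.arc.start, h.arc.finish] using h2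

lemma start_notMem (h : IsPocket G A O p q k k' b b') : p ∉ O := fun hp =>
  ((h.mem_iff p).1 hp).1 0 (by omega) h.arc.start.symm

lemma gap_eq (hc : G.Connected) (h : IsPocket G A O p q k k' b b') {x : V} (hx : x ∈ O) :
    (G.dist (b 1) x : ℤ) - G.dist p x + (G.dist (b (k - 1)) x - G.dist q x) =
      min 1 (k - 1 - ((G.dist p x : ℤ) - G.dist q x)) +
        min 1 (k - 1 + ((G.dist p x : ℤ) - G.dist q x)) := by
  have hx' : ∀ i, 0 < i → i < k → x ≠ b i := fun i _ hi => ((h.mem_iff x).1 hx).1 i hi.le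
  have hk := h.arc.pos
  rw [h.arc.dist_eq hc hx' (i := 1) hk, h.arc.dist_eq hc hx' (i := k - 1) (by omega)]
  omega

lemma abs_dist_sub_le (hc : G.Connected) (h : IsPocket G A O p q k k' b b') (x : V) :
    |(G.dist p x : ℤ) - G.dist q x| ≤ k := by
  refine (abs_dist_sub_dist_le hc q p x).trans ?_
  rw [dist_comm]
  exact_mod_cast h.arc.dist_le hc

lemma gap_nonneg (hc : G.Connected) (h : IsPocket G A O p q k k' b b') {x : V} (hx : x ∈ O) :
    0 ≤ (G.dist (b 1) x : ℤ) - G.dist p x + (G.dist (b (k - 1)) x - G.dist q x) := by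
  rw [h.gap_eq hc hx]
  have := abs_le.1 (h.abs_dist_sub_le hc x)
  have := h.arc.pos
  omega

lemma exists_walk_outside (hG : LowEnergy G) (h : IsPocket G A O p q k k' b b') {x : V}
    (hx : x ∈ O) : ∃ o ∈ O, G.Adj q o ∧ ∃ W : G.Walk x o, ∀ z ∈ W.support, z ∈ O := by
  have hxp : x ≠ p := fun e1 => h.start_notMem (e1 ▸ hx)
  obtain ⟨W, hW⟩ := hG.exists_walk hxp h.arc.ne.symm
  obtain ⟨c, d, hcO, hd, hdW, hcd, W', hW'⟩ := exists_walk_prefix W (O : Set V) hx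
    h.reverse.start_notMem
  have hcO : c ∈ O := hcO
  have hdp : d ≠ p := fun e1 => hW (e1 ▸ hdW)
  have hdq : d = q := by
    have hd : d ∉ O := hd
    rw [h.mem_iff] at hd
    have hcO' := (h.mem_iff c).1 hcO
    have key : ∀ i ≤ k, d = b i → d = q := by
      rintro i hi rfl
      by_contra hq
      have h0 : 0 < i := Nat.pos_of_ne_zero fun h0 => hdp (h0 ▸ h.arc.start)
      have h1 : i < k := hi.lt_of_ne fun h1 => hq (h1 ▸ h.arc.finish)
      rcases ((h.arc.bivalent i h0 h1).adj_iff c).1 hcd.symm with h2 | h2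
      · exact hcO'.1 (i - 1) (by omega) h2
      · exact hcO'.1 (i + 1) (by omega) h2
    have key' : ∀ i ≤ k', d = b' i → d = q := by
      rintro i hi rfl
      by_contra hq
      have h0 : 0 < i := Nat.pos_of_ne_zero fun h0 => hdp (h0 ▸ h.arc'.start)
      have h1 : i < k' := hi.lt_of_ne fun h1 => hq (h1 ▸ h.arc'.finish)
      rcases ((h.arc'.bivalent i h0 h1).adj_iff c).1 hcd.symm with h2 | h2
      · exact hcO'.2 (i - 1) (by omega) h2
      · exact hcO'.2 (i + 1) (by omega) h2
    by_contra hq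
    exact hd ⟨fun i hi e1 => hq (key i hi e1), fun i hi e1 => hq (key' i hi e1)⟩
  exact ⟨c, hcO, hdq ▸ hcd.symm, W', hW'⟩

lemma exists_balanced (hG : LowEnergy G) (h : IsPocket G A O p q k k' b b') {y w : V}
    (hy : y ∈ O) (hw : w ∈ O) (hyw : G.Adj y w) :
    (∃ x ∈ O, (G.dist p x : ℤ) - G.dist q x = 0 ∧ ∃ x' ∈ O, G.Adj x x') ∨
      ∃ x ∈ O, ∃ x' ∈ O, G.Adj x x' ∧ (G.dist p x : ℤ) - G.dist q x = 1 ∧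
        (G.dist p x' : ℤ) - G.dist q x' = -1 := by
  obtain ⟨o, ho, hqo, W, hW⟩ := h.exists_walk_outside hG hy
  obtain ⟨o', ho', hpo', W', hW'⟩ := h.reverse.exists_walk_outside hG hy
  have hmem : ∀ x ∈ (W.reverse.append W').support, x ∈ W.support ∨ x ∈ W'.support := by
    intro x hx
    simpa [Walk.mem_support_append_iff] using hx
  have hmemO : ∀ x ∈ (W.reverse.append W').support, x ∈ O := fun x hx =>
    (hmem x hx).elim (hW x) (hW' x)
  have h1 : 0 < G.dist p o := hG.conn.pos_dist_of_ne fun e1 => h.start_notMem (e1 ▸ ho)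
  have h2 : 0 < G.dist q o' := hG.conn.pos_dist_of_ne fun e1 => h.reverse.start_notMem (e1 ▸ ho')
  have h3 := dist_eq_one_iff_adj.2 hqo
  have h4 := dist_eq_one_iff_adj.2 hpo'
  rcases exists_zero_or_sign_change (W.reverse.append W')
    (fun x => (G.dist p x : ℤ) - G.dist q x)
    (fun _ _ h => abs_dist_diff_le hG.conn p q h) (by omega) (by omega)
    with ⟨x, hx, h0⟩ | ⟨x, hx, x', hx', hxx, hx1, hx1'⟩
  · refine Or.inl ⟨x, hmemO x hx, h0, ?_⟩
    by_cases hxy : x = y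
    · exact ⟨w, hw, hxy ▸ hyw⟩
    · rcases hmem x hx with hx | hx
      · obtain ⟨r, hr, hxr⟩ := exists_adj_mem_support (W.takeUntil x hx).reverse hxy
        rw [Walk.support_reverse, List.mem_reverse] at hr
        exact ⟨r, hW r (Walk.support_takeUntil_subset_support _ _ hr), hxr⟩
      · obtain ⟨r, hr, hxr⟩ := exists_adj_mem_support (W'.takeUntil x hx).reverse hxy
        rw [Walk.support_reverse, List.mem_reverse] at hr
        exact ⟨r, hW' r (Walk.support_takeUntil_subset_support _ _ hr), hxr⟩
  · exact Or.inr ⟨x, hmemO x hx, x', hmemO x' hx', hxx, hx1, hx1'⟩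

end IsPocket

/-- The two end edges of the sequence `b 0, …, b k`. -/
noncomputable def endEdges {V : Type*} (b : ℕ → V) (k : ℕ) : Finset (Sym2 V) :=
  {s(b 0, b 1), s(b (k - 1), b k)}

namespace IsArc

variable {V : Type*} [Fintype V] {G : SimpleGraph V} {p q : V} {k : ℕ} {b : ℕ → V}

lemma endEdges_subset (h : IsArc G p q k b) : endEdges b k ⊆ G.edgeFinset := by
  have h0 := h.adj 0 h.pos
  have h1 := h.adj (k - 1) (by have := h.pos; omega)
  rw [Nat.sub_add_cancel h.pos] at h1
  simp [endEdges, insert_subset_iff, h0, h1]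

lemma sum_endEdges (h : IsArc G p q k b) (hk : 2 ≤ k) :
    ∑ e ∈ endEdges b k, edgeEnergy G e = (transmission G (b 1) - transmission G p) ^ 2 +
      (transmission G (b (k - 1)) - transmission G q) ^ 2 := by
  have hne : s(b 0, b 1) ≠ s(b (k - 1), b k) := by
    rw [Ne, Sym2.eq_iff]
    rintro (⟨h1, -⟩ | ⟨h1, -⟩)
    · have := h.inj _ _ (by omega) (by omega) h1
      omega
    · have := h.inj _ _ (by omega) (by omega) h1
      omega
  rw [endEdges, sum_pair hne, edgeEnergy_mk, edgeEnergy_mk, h.start, h.finish]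
  ring

end IsArc

lemma LowEnergy.sum_le {V : Type*} [Fintype V] {G : SimpleGraph V} (h : LowEnergy G)
    {F : Finset (Sym2 V)} (hF : F ⊆ G.edgeFinset) : ∑ e ∈ F, edgeEnergy G e ≤ 17 :=
  (sum_le_sum_of_subset_of_nonneg hF fun e _ _ => edgeEnergy_nonneg e).trans h.low

namespace IsPocket

variable {V : Type*} [Fintype V] {G : SimpleGraph V} {A O : Finset V} {p q : V} {k k' : ℕ}
  {b b' : ℕ → V}

lemma disjoint_endEdges (h : IsPocket G A O p q k k' b b') (hk : 2 ≤ k) :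
    Disjoint (endEdges b k) (endEdges b' k') := by
  have key : ∀ i j, 0 < i → i < k → j ≤ k' → b i ≠ b' j := by
    intro i j h0 h1 hj h2
    rcases Nat.eq_zero_or_pos j with rfl | hj0
    · rw [h.arc'.start, ← h.arc.start] at h2
      have := h.arc.inj _ _ h1.le (by omega) h2
      omega
    · rcases hj.eq_or_lt with rfl | hj1
      · rw [h.arc'.finish, ← h.arc.finish] at h2
        have := h.arc.inj _ _ h1.le le_rfl h2
        omega
      · exact h.disj i j h0 h1 hj0 hj1 h2
  have hk' := h.arc'.pos
  have hmem : ∀ e ∈ endEdges b' k', ∀ i, 0 < i → i < k → b i ∉ e := by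
    intro e he i h0 h1
    simp only [endEdges, mem_insert, mem_singleton] at he
    rcases he with rfl | rfl
    · rw [Sym2.mem_iff]
      rintro (h2 | h2)
      · exact key _ _ h0 h1 (by omega) h2
      · exact key _ _ h0 h1 (by omega) h2
    · rw [Sym2.mem_iff]
      rintro (h2 | h2)
      · exact key _ _ h0 h1 (by omega) h2
      · exact key _ _ h0 h1 (by omega) h2
  refine disjoint_left.2 fun e he he' => ?_
  have h3 := hmem e he'
  simp only [endEdges, mem_insert, mem_singleton] at he
  rcases he with rfl | rfl
  · exact h3 1 (by omega) (by omega) (by simp)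
  · exact h3 (k - 1) (by omega) (by omega) (by simp)

lemma mem_of_mem_endEdges (h : IsPocket G A O p q k k' b b') {e : Sym2 V}
    (he : e ∈ endEdges b k ∪ endEdges b' k') : ∀ x ∈ e, x ∈ A := by
  have hk := h.arc.pos
  have hk' := h.arc'.pos
  simp only [endEdges, mem_union, mem_insert, mem_singleton] at he
  intro x hx
  rcases he with (rfl | rfl) | rfl | rfl <;> rcases Sym2.mem_iff.1 hx with rfl | rfl
  · exact h.mem_left _ (by omega)
  · exact h.mem_left _ (by omega)
  · exact h.mem_left _ (by omega)
  · exact h.mem_left _ (by omega)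
  · exact h.mem_right _ (by omega)
  · exact h.mem_right _ (by omega)
  · exact h.mem_right _ (by omega)
  · exact h.mem_right _ (by omega)

lemma length_le (hG : LowEnergy G) (h : IsPocket G A O p q k k' b b') (hO : 6 ≤ O.card) :
    k ≤ k' := by
  by_contra! hk
  have h1 := h.sum_le hG.conn
  have h2 : ∑ x ∈ O, (1 : ℤ) ≤ ∑ x ∈ O, ((G.dist (b 1) x : ℤ) - G.dist p x +
      (G.dist (b (k - 1)) x - G.dist q x)) := by
    refine sum_le_sum fun x hx => ?_
    rw [h.gap_eq hG.conn hx]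
    have := abs_le.1 (h.swap.abs_dist_sub_le hG.conn x)
    have := h.three_le
    omega
  have h3 := hG.sum_le h.arc.endEdges_subset
  rw [h.arc.sum_endEdges (by have := h.three_le; omega)] at h3
  rw [sum_const, nsmul_eq_mul, mul_one] at h2
  have h4 : (6 : ℤ) ≤ O.card := by exact_mod_cast hO
  nlinarith [sq_nonneg ((transmission G (b 1) - transmission G p) -
        (transmission G (b (k - 1)) - transmission G q))]

lemma sum_endEdges_ge_of_three_le (hG : LowEnergy G) (h : IsPocket G A O p q k k' b b')
    (hk : 3 ≤ k) {y w : V} (hy : y ∈ O) (hw : w ∈ O) (hyw : G.Adj y w) (hkk : k' = k) :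
    5 ≤ ∑ e ∈ endEdges b k, edgeEnergy G e := by
  have h1 := h.sum_le hG.conn
  have h2 : 3 ≤ ∑ x ∈ O, ((G.dist (b 1) x : ℤ) - G.dist p x +
      (G.dist (b (k - 1)) x - G.dist q x)) := by
    have key : ∀ {x x'}, x ∈ O → x' ∈ O → G.Adj x x' →
        3 ≤ ((G.dist (b 1) x : ℤ) - G.dist p x + (G.dist (b (k - 1)) x - G.dist q x)) +
          ((G.dist (b 1) x' : ℤ) - G.dist p x' + (G.dist (b (k - 1)) x' - G.dist q x')) →
        3 ≤ ∑ x ∈ O, ((G.dist (b 1) x : ℤ) - G.dist p x +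
          (G.dist (b (k - 1)) x - G.dist q x)) := by
      intro x x' hx hx' hxx h3
      have h4 := sum_le_sum_of_subset_of_nonneg (s := {x, x'}) (t := O)
        (f := fun x => (G.dist (b 1) x : ℤ) - G.dist p x + (G.dist (b (k - 1)) x - G.dist q x))
        (by simp [insert_subset_iff, hx, hx']) fun z hz _ => h.gap_nonneg hG.conn hz
      rw [sum_pair hxx.ne] at h4
      exact h3.trans h4
    rcases h.exists_balanced hG hy hw hyw with ⟨x, hx, h0, x', hx', hxx⟩ |
      ⟨x, hx, x', hx', hxx, h0, h0'⟩
    · refine key hx hx' hxx ?_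
      rw [h.gap_eq hG.conn hx, h.gap_eq hG.conn hx']
      have := abs_le.1 (abs_dist_diff_le hG.conn p q hxx)
      omega
    · refine key hx hx' hxx ?_
      rw [h.gap_eq hG.conn hx, h.gap_eq hG.conn hx']
      omega
  rw [h.arc.sum_endEdges (by omega)]
  have h3 := h2.trans h1
  generalize transmission G (b 1) - transmission G p = s at *
  generalize transmission G (b (k - 1)) - transmission G q = t at *
  have : 9 ≤ (s + t) ^ 2 := by nlinarith
  have : 0 ≤ (s - t) ^ 2 := sq_nonneg _
  have : 9 ≤ 2 * (s ^ 2 + t ^ 2) := by linarith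
  omega

end IsPocket

namespace Split

variable {V : Type*} [Fintype V] {G : SimpleGraph V} {y u w e e' : V} {ε : ℕ} {A A' : Finset V}
  {O : Finset V} {p q : V} {k k' : ℕ} {b b' : ℕ → V}

lemma mem_outside (hP : IsPocket G A O p q k k' b b') {x : V} (hx : x ∉ A) : x ∈ O :=
  (hP.mem_iff x).2 ⟨fun i hi e1 => hx (e1 ▸ hP.mem_left i hi),
    fun i hi e1 => hx (e1 ▸ hP.mem_right i hi)⟩

lemma card_outside (hG : LowEnergy G) (h : Split G y u w e e' ε A A')
    (hP : IsPocket G A O p q k k' b b') : 6 ≤ O.card := by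
  have h1 : Aᶜ ⊆ O := fun x hx => mem_outside hP (mem_compl.1 hx)
  have h2 := card_le_card h1
  have h3 := h.card
  have h4 := hG.large
  rw [card_compl] at h2
  rcases h.kind with h5 | h5 <;> omega

lemma length_eq (hG : LowEnergy G) (h : Split G y u w e e' ε A A')
    (hP : IsPocket G A O p q k k' b b') : k' = k :=
  le_antisymm (hP.swap.length_le hG (h.card_outside hG hP)) (hP.length_le hG (h.card_outside hG hP))

lemma sum_endEdges_ge_of_three_le (hG : LowEnergy G) (h : Split G y u w e e' ε A A')
    (hP : IsPocket G A O p q k k' b b') (hk : 3 ≤ k) :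
    10 ≤ ∑ e ∈ endEdges b k ∪ endEdges b' k', edgeEnergy G e := by
  have hkk := h.length_eq hG hP
  have hy := mem_outside hP h.notMem_left
  have hw := mem_outside hP h.right_start_notMem
  rw [sum_union (hP.disjoint_endEdges (by omega))]
  have h1 := hP.sum_endEdges_ge_of_three_le hG hk hy hw h.bivalent.adj_right hkk
  have h2 := hP.swap.sum_endEdges_ge_of_three_le hG (by omega) hy hw h.bivalent.adj_right hkk.symm
  linarith

end Split

/-- A four-cycle `p z q z'` with bivalent `z`, `z'` such that `p` and `q` are as unevenly distant
from every other vertex as possible, up to one balanced vertex (`τ = 0`, `x₁ = x₂`) or one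
balanced edge `x₁x₂` (`τ = 1`). -/
structure IsTight {V : Type*} (G : SimpleGraph V) (p q z z' x₁ x₂ : V) (τ : ℕ) : Prop where
  bivalent : IsBivalent G z p q
  bivalent' : IsBivalent G z' p q
  ne : z ≠ z'
  dist_eq_two : G.dist p q = 2
  left : G.dist p x₁ + τ = G.dist q x₁
  right : G.dist q x₂ + τ = G.dist p x₂
  kind : (τ = 0 ∧ x₁ = x₂) ∨ (τ = 1 ∧ G.Adj x₁ x₂)
  ne_left : x₁ ≠ z ∧ x₁ ≠ z'
  ne_right : x₂ ≠ z ∧ x₂ ≠ z'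
  far : ∀ x, x ≠ x₁ → x ≠ x₂ → x ≠ z → x ≠ z' →
    G.dist p x + 2 = G.dist q x ∨ G.dist q x + 2 = G.dist p x

namespace IsTight

variable {V : Type*} [Fintype V] {G : SimpleGraph V} {p q z z' x₁ x₂ : V} {τ : ℕ}

lemma reverse (h : IsTight G p q z z' x₁ x₂ τ) : IsTight G q p z z' x₂ x₁ τ where
  bivalent := h.bivalent.symm
  bivalent' := h.bivalent'.symm
  ne := h.ne
  dist_eq_two := by rw [dist_comm, h.dist_eq_two]
  left := h.right
  right := h.left
  kind := by
    have := h.kind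
    rwa [eq_comm (a := x₂), adj_comm]
  ne_left := h.ne_right
  ne_right := h.ne_left
  far x h1 h2 h3 h4 := (h.far x h2 h1 h3 h4).symm

lemma swap (h : IsTight G p q z z' x₁ x₂ τ) : IsTight G p q z' z x₁ x₂ τ :=
  { h with
    bivalent := h.bivalent'
    bivalent' := h.bivalent
    ne := h.ne.symm
    ne_left := h.ne_left.symm
    ne_right := h.ne_right.symm
    far := fun x h1 h2 h3 h4 => h.far x h1 h2 h4 h3 }

lemma dist_left (h : IsTight G p q z z' x₁ x₂ τ) : G.dist p z = 1 :=
  dist_eq_one_iff_adj.2 h.bivalent.adj_left.symm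

lemma exists_crossing (hc : G.Connected) (h : IsTight G p q z z' x₁ x₂ τ) {a c : V}
    (W : G.Walk a c) (ha : G.dist p a < G.dist q a) (hcq : G.dist q c ≤ G.dist p c) :
    z ∈ W.support ∨ z' ∈ W.support ∨
      x₁ ∈ W.support ∧ G.dist a x₁ + τ + G.dist x₂ c ≤ W.length := by
  obtain ⟨d, hd, h1, h2⟩ := W.exists_boundary_dart {x | G.dist p x < G.dist q x} ha
    (by simpa using hcq)
  simp only [Set.mem_ofPred_eq, not_lt] at h1 h2
  have h3 := abs_le.1 (abs_dist_diff_le hc p q d.adj)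
  have hs := W.dart_snd_mem_support_of_mem_darts hd
  have hf := W.dart_fst_mem_support_of_mem_darts hd
  by_cases hz : d.snd = z
  · exact Or.inl (hz ▸ hs)
  by_cases hz' : d.snd = z'
  · exact Or.inr (Or.inl (hz' ▸ hs))
  refine Or.inr (Or.inr ?_)
  have hl := h.left
  have hr := h.right
  have hfz : d.fst ≠ z := fun e1 => by
    rw [e1, h.dist_left, h.reverse.dist_left] at h1; omega
  have hfz' : d.fst ≠ z' := fun e1 => by
    rw [e1, h.swap.dist_left, h.reverse.swap.dist_left] at h1; omega
  have hfx₂ : d.fst ≠ x₂ := fun e1 => by rw [e1] at h1; omega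
  rcases h.kind with ⟨rfl, rfl⟩ | ⟨rfl, hx⟩
  · have h4 := h.far d.fst hfx₂ hfx₂ hfz hfz'
    have h5 : d.snd = x₁ := by
      by_contra h5
      have := h.far d.snd h5 h5 hz hz'
      omega
    rw [h5] at hs
    exact ⟨hs, by simpa using dist_add_dist_le_of_mem_support W hs⟩
  · have hsx₁ : d.snd ≠ x₁ := fun e1 => by rw [e1] at h2; omega
    have h5 : d.snd = x₂ := by
      by_contra h5
      have h6 := h.far d.snd hsx₁ h5 hz hz'
      by_cases h7 : d.fst = x₁
      · rw [h7] at h3 h1; omega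
      · have := h.far d.fst h7 hfx₂ hfz hfz'
        omega
    have h6 : d.fst = x₁ := by
      by_contra h6
      have := h.far d.fst h6 hfx₂ hfz hfz'
      rw [h5] at h3
      omega
    have h7 := dist_add_one_add_dist_le_of_mem_darts W hd
    rw [h5, h6] at h7
    exact ⟨h6 ▸ hf, h7⟩

lemma dist_right_eq (hc : G.Connected) (h : IsTight G p q z z' x₁ x₂ 1) {x : V}
    (hx : G.dist p x < G.dist q x) : G.dist x x₂ = G.dist x x₁ + 1 := by
  have hadj : G.Adj x₁ x₂ := by
    rcases h.kind with h1 | h1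
    · omega
    · exact h1.2
  have h1 := dist_le_succ_of_adj hc hadj.symm x
  rw [dist_comm, dist_comm (u := x₁)] at h1
  refine le_antisymm h1 ?_
  have hl := h.left
  have hr := h.right
  have h2 := abs_le.1 (abs_dist_diff_le hc p q hadj)
  have h3 := dist_le_succ_of_adj hc hadj q
  rw [dist_comm, dist_comm (u := x₂)] at h3
  have h4 := hc.dist_triangle (u := x) (v := p) (w := x₁)
  rw [dist_comm (u := x) (v := p)] at h4
  obtain ⟨W, hW⟩ := hc.exists_walk_length_eq_dist x x₂
  have key : ∀ {z z'}, IsTight G p q z z' x₁ x₂ 1 → z ∈ W.support →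
      G.dist x x₁ + 1 ≤ G.dist x x₂ := by
    intro z z' h hz
    have h5 := dist_add_dist_le_of_mem_support W hz
    have h6 := h.bivalent.dist_eq hc h.ne_right.1
    have hxz : x ≠ z := by
      rintro rfl
      rw [h.dist_left, h.reverse.dist_left] at hx; omega
    have h7 := h.bivalent.dist_eq hc hxz
    rw [dist_comm] at h7
    omega
  rcases h.exists_crossing hc W hx (by omega) with h5 | h5 | ⟨-, h5⟩
  · exact key h h5
  · exact key h.swap h5
  · simp at h5
    omega

lemma dist_eq_of_bivalent (hc : G.Connected) (h : IsTight G p q z z' x₁ x₂ 1) :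
    G.dist z x₁ = G.dist z x₂ := by
  have hadj : G.Adj x₁ x₂ := by
    rcases h.kind with h1 | h1
    · omega
    · exact h1.2
  have h1 := h.bivalent.dist_eq hc h.ne_left.1
  have h2 := h.bivalent.dist_eq hc h.ne_right.1
  have hl := h.left
  have hr := h.right
  have h3 := dist_le_succ_of_adj hc hadj p
  have h4 := dist_le_succ_of_adj hc hadj.symm p
  have h5 := dist_le_succ_of_adj hc hadj q
  have h6 := dist_le_succ_of_adj hc hadj.symm q
  simp only [dist_comm (v := p), dist_comm (v := q)] at h3 h4 h5 h6
  omega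

lemma odd_edgeEnergy (hc : G.Connected) (h : IsTight G p q z z' x₁ x₂ 1)
    (hn : Odd (Fintype.card V)) : Odd (edgeEnergy G s(x₁, x₂)) := by
  have key : (2 : ℤ) ∣ ∑ x, ((G.dist x₁ x : ℤ) - G.dist x₂ x - 1 + (if x = z then 1 else 0) +
      if x = z' then 1 else 0) := by
    refine dvd_sum fun x _ => ?_
    rw [dist_comm, dist_comm (u := x₂)]
    by_cases hz : x = z
    · subst hz
      simp [h.ne, h.dist_eq_of_bivalent hc]
    by_cases hz' : x = z'
    · subst hz'
      simp [h.ne.symm, h.swap.dist_eq_of_bivalent hc]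
    rw [if_neg hz, if_neg hz']
    rcases lt_trichotomy (G.dist p x) (G.dist q x) with h1 | h1 | h1
    · have := h.dist_right_eq hc h1
      omega
    · exfalso
      have hl := h.left
      have hr := h.right
      have := h.far x (fun e1 => by subst e1; omega) (fun e1 => by subst e1; omega) hz hz'
      omega
    · have := h.reverse.dist_right_eq hc h1
      omega
  simp only [sum_add_distrib, sum_sub_distrib, sum_ite_single] at key
  rw [edgeEnergy_mk]
  refine Odd.pow ?_
  have h2 : ∑ x : V, (1 : ℤ) = Fintype.card V := by simp
  rw [h2] at key
  change (2 : ℤ) ∣ transmission G x₁ - transmission G x₂ - Fintype.card V + 1 + 1 at key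
  obtain ⟨m, hm⟩ := hn
  rw [hm] at key
  rw [Int.odd_iff]
  push_cast at key
  omega

lemma four_dvd (h : IsTight G p q z z' x₁ x₂ τ) :
    (4 : ℤ) ∣ transmission G p - transmission G q - 2 * Fintype.card V + 6 + 2 * τ := by
  have key : (4 : ℤ) ∣ ∑ x, ((G.dist p x : ℤ) - G.dist q x - 2 + (if x = z then 2 else 0) +
      (if x = z' then 2 else 0) + (if x = x₁ then (2 + τ : ℤ) else 0) +
      if x = x₂ then (τ : ℤ) else 0) := by
    refine dvd_sum fun x _ => ?_
    by_cases hz : x = z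
    · subst hz
      simp [h.ne, h.ne_left.1.symm, h.ne_right.1.symm, h.dist_left, h.reverse.dist_left]
    by_cases hz' : x = z'
    · subst hz'
      simp [h.ne.symm, h.ne_left.2.symm, h.ne_right.2.symm, h.swap.dist_left,
        h.reverse.swap.dist_left]
    rw [if_neg hz, if_neg hz']
    have hl := h.left
    have hr := h.right
    by_cases h1 : x = x₁
    · subst h1
      rw [if_pos rfl]
      rcases h.kind with ⟨rfl, rfl⟩ | ⟨rfl, hx⟩
      · rw [if_pos rfl]; omega
      · rw [if_neg hx.ne]; omega
    rw [if_neg h1]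
    by_cases h2 : x = x₂
    · subst h2
      rw [if_pos rfl]
      rcases h.kind with ⟨rfl, rfl⟩ | ⟨rfl, hx⟩
      · exact absurd rfl h1
      · omega
    rw [if_neg h2]
    have := h.far x h1 h2 hz hz'
    omega
  simp only [sum_add_distrib, sum_sub_distrib, sum_ite_single] at key
  have h2 : ∑ x : V, (2 : ℤ) = 2 * Fintype.card V := by simp [mul_comm]
  rw [h2] at key
  change (4 : ℤ) ∣ transmission G p - transmission G q - _ + _ + _ + _ + _ at key
  convert key using 1
  ring

end IsTight

namespace Split

variable {V : Type*} [Fintype V] {G : SimpleGraph V} {y u w e e' : V} {ε : ℕ} {A A' : Finset V}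
  {p q z z' x₁ x₂ : V} {τ : ℕ}

lemma dist_start_sub (h : Split G y u w e e' ε A A') (hp : p ∈ A) : G.dist p y = G.dist p u + 1 := by
  rw [dist_comm, h.dist_left hp, dist_comm]

lemma far_start (h : Split G y u w e e' ε A A')
    (hT : IsTight G p q z z' x₁ x₂ τ) (hp : p ∈ A) (hq : q ∈ A) (hz : z ∈ A) (hz' : z' ∈ A) :
    G.dist p y + 2 = G.dist q y ∨ G.dist q y + 2 = G.dist p y := by
  have hyu := h.bivalent.adj_left
  have hy : ∀ x ∈ A, y ≠ x := fun x hx => (h.ne_of_mem hx).symm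
  have huz : ∀ {z z'}, IsTight G p q z z' x₁ x₂ τ → u ≠ z := by
    rintro z z' hT rfl
    rcases (hT.bivalent.adj_iff y).1 hyu.symm with h1 | h1
    · exact hy p hp h1
    · exact hy q hq h1
  have h1 := h.dist_start_sub hp
  have h2 := h.dist_start_sub hq
  have hl := hT.left
  have hr := hT.right
  by_contra hno
  have h3 : y = x₁ ∨ y = x₂ := by
    by_contra! h3
    exact hno (hT.far y h3.1 h3.2 (hy z hz) (hy z' hz'))
  have h4 : u = x₁ ∨ u = x₂ := by
    by_contra! h4
    have := hT.far u h4.1 h4.2 (huz hT) (huz hT.swap)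
    omega
  have hne := hyu.ne
  rcases hT.kind with ⟨rfl, rfl⟩ | ⟨rfl, hx⟩
  · rcases h3 with rfl | rfl <;> rcases h4 with rfl | rfl <;> exact hne rfl
  · rcases h3 with rfl | rfl <;> rcases h4 with rfl | rfl
    · exact hne rfl
    · omega
    · omega
    · exact hne rfl

lemma dist_bridge_le (h : Split G y u w e e' ε A A') : G.dist e' e ≤ ε := by
  rcases h.kind with ⟨rfl, rfl, -⟩ | ⟨rfl, h1⟩
  · simp
  · rw [dist_eq_one_iff_adj.2 h1.symm]

lemma lt_dist_of_tight (hc : G.Connected) (h : Split G y u w e e' ε A A')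
    (hT : IsTight G p q z z' x₁ x₂ τ) (hp : p ∈ A) (hq : q ∈ A) (hz : z ∈ A) (hz' : z' ∈ A)
    (hy : G.dist p y + 2 = G.dist q y) (hpq : -2 ≤ transmission G p - transmission G q) :
    G.dist q e < G.dist p e := by
  by_contra! he
  have hA' : ∀ x ∈ A', G.dist p x ≤ G.dist q x := by
    intro x hx
    have h1 := hc.dist_triangle (u := p) (v := y) (w := x)
    have h2 := hc.dist_triangle (u := p) (v := e) (w := x)
    have h3 := hc.dist_triangle (u := e) (v := e') (w := x)
    have h4 := h.dist_bridge_le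
    have h5 := h.dist_cross hc hx hq
    simp only [dist_comm (u := x), dist_comm (u := e') (v := e), dist_comm (v := q)] at *
    omega
  have hl := hT.left
  have hr := hT.right
  have h2 := hT.dist_eq_two
  have hle : ∀ x, G.dist p x ≤ G.dist q x + 2 := fun x => by
    have := hc.dist_triangle (u := p) (v := q) (w := x)
    omega
  have hpz := hT.bivalent.adj_left.ne
  have hpz' := hT.bivalent'.adj_left.ne
  have hsum := sum_le_sum (s := univ) fun (x : V) _ => show (G.dist p x : ℤ) - G.dist q x ≤
      4 * (if x ∈ A then 1 else 0) - 2 + (if x = x₁ then 2 else 0) - (if x = p then 4 else 0) -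
        (if x = z then 2 else 0) - (if x = z' then 2 else 0) by
    have hx2 := hle x
    have hpos : (0 : ℤ) ≤ if x = x₁ then 2 else 0 := by split_ifs <;> norm_num
    by_cases hxp : x = p
    · subst hxp
      rw [if_pos hp, if_pos rfl, if_neg hpz.symm, if_neg hpz'.symm, G.dist_self, dist_comm, h2]
      push_cast
      linarith
    by_cases hxz : x = z
    · subst hxz
      rw [if_pos hz, if_pos rfl, if_neg hxp, if_neg hT.ne, hT.dist_left, hT.reverse.dist_left]
      push_cast
      linarith
    by_cases hxz' : x = z'
    · subst hxz'
      rw [if_pos hz', if_pos rfl, if_neg hxp, if_neg hxz, hT.swap.dist_left,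
        hT.reverse.swap.dist_left]
      push_cast
      linarith
    rw [if_neg hxp, if_neg hxz, if_neg hxz']
    by_cases hxA : x ∈ A
    · rw [if_pos hxA]; omega
    · rw [if_neg hxA]
      have h3 : G.dist p x ≤ G.dist q x := by
        by_cases hxy : x = y
        · subst hxy; omega
        · exact hA' x (h.cover hc hxy hxA)
      by_cases hx₁ : x = x₁
      · rw [if_pos hx₁]; omega
      · rw [if_neg hx₁]
        by_cases hx₂ : x = x₂
        · exfalso
          subst hx₂
          rcases hT.kind with ⟨rfl, rfl⟩ | ⟨rfl, hx⟩
          · exact hx₁ rfl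
          · omega
        · have := hT.far x hx₁ hx₂ hxz hxz'
          omega
  simp only [sum_add_distrib, sum_sub_distrib, sum_ite_single, ← mul_sum,
    ← cast_card_eq_sum_ite] at hsum
  have h3 : ∑ x : V, (2 : ℤ) = 2 * Fintype.card V := by simp [mul_comm]
  rw [h3, h.card] at hsum
  change transmission G p - transmission G q ≤ _ at hsum
  push_cast at hsum
  linarith

lemma exists_walk_through_right (hc : G.Connected) (h : Split G y u w e e' ε A A') :
    ∃ W : G.Walk y e', W.length = G.dist y e' ∧ ∀ x ∈ W.support, x = y ∨ x ∈ A' := by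
  obtain ⟨W, hW, hA⟩ := h.symm.exists_walk_left hc h.right_mem
  refine ⟨Walk.cons h.bivalent.adj_right W, ?_, fun x hx => ?_⟩
  · rw [Walk.length_cons, hW, h.symm.dist_left h.right_mem]
  · rw [Walk.support_cons, List.mem_cons] at hx
    exact hx.imp_right (hA x)

lemma tight_parity_aux (hc : G.Connected) (h : Split G y u w e e' ε A A')
    (hT : IsTight G p q z z' x₁ x₂ τ) (hp : p ∈ A) (hq : q ∈ A) (hz : z ∈ A) (hz' : z' ∈ A)
    (hy : G.dist p y + 2 = G.dist q y) (hpq : -2 ≤ transmission G p - transmission G q) :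
    τ = ε := by
  have he := h.lt_dist_of_tight hc hT hp hq hz hz' hy hpq
  have hl := hT.left
  have hr := hT.right
  have hez : ∀ {z z'}, IsTight G p q z z' x₁ x₂ τ → e ≠ z := by
    rintro z z' hT rfl
    rw [hT.dist_left, hT.reverse.dist_left] at he; omega
  have hex₁ : e ≠ x₁ := by rintro rfl; omega
  have hyx₁ : x₁ ≠ y := by
    rintro rfl
    rcases hT.kind with h1 | h1 <;> omega
  obtain ⟨W, hW, hWA⟩ := h.exists_walk_through_right hc
  obtain ⟨W₁, hW₁⟩ : ∃ W₁ : G.Walk y e, ∀ x ∈ W₁.support, x = e ∨ x ∈ W.support := by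
    rcases h.kind with ⟨-, rfl, -⟩ | ⟨-, h1⟩
    · exact ⟨W, fun x hx => Or.inr hx⟩
    · refine ⟨W.concat h1.symm, fun x hx => ?_⟩
      rw [Walk.support_concat, List.mem_append, List.mem_singleton] at hx
      exact hx.symm
  have hzW : ∀ {z z'}, IsTight G p q z z' x₁ x₂ τ → z ∈ A → z ∉ W₁.support := by
    intro z z' hT hz hzW
    rcases hW₁ z hzW with h1 | h1
    · exact hez hT h1.symm
    · rcases hWA z h1 with h2 | h2
      · exact h.ne_of_mem hz h2
      · exact hez hT (h.inter z hz h2).1.symm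
  have hx₁W : x₁ ∈ W.support := by
    rcases hT.exists_crossing hc W₁ (by omega) he.le with h1 | h1 | ⟨h1, -⟩
    · exact absurd h1 (hzW hT hz)
    · exact absurd h1 (hzW hT.swap hz')
    · exact (hW₁ _ h1).resolve_left hex₁.symm
  have hx₁A' : x₁ ∈ A' := (hWA _ hx₁W).resolve_left hyx₁
  have hx₁A : x₁ ∉ A := fun h1 => hex₁ (h.inter _ h1 hx₁A').1.symm
  have hlen := dist_add_dist_le_of_mem_support W hx₁W
  obtain ⟨X, hX, hXA⟩ := h.exists_walk_left hc h.left_mem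
  have hpu := h.dist_start_sub hp
  have hqu := h.dist_start_sub hq
  have hLe := h.dist_left h.left_mem
  have key : ∀ {z z'}, IsTight G p q z z' x₁ x₂ τ → z ∈ X.support →
      G.dist p y + G.dist q e + 2 ≤ G.dist y e := by
    intro z z' hT hzX
    have h1 := dist_add_dist_le_of_mem_support X hzX
    have h2 := hT.bivalent.dist_eq hc (hez hT)
    have huz : u ≠ z := by
      rintro rfl
      rw [hT.dist_left] at hpu
      rw [hT.reverse.dist_left] at hqu
      omega
    have h3 := hT.bivalent.dist_eq hc huz
    rw [dist_comm] at h3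
    omega
  have hL : G.dist p y + G.dist q e + 2 ≤ G.dist y e := by
    rcases hT.exists_crossing hc X (by omega) he.le with h1 | h1 | ⟨h1, -⟩
    · exact key hT h1
    · exact key hT.swap h1
    · exact absurd (hXA _ h1) hx₁A
  have h1 := h.dist_cross hc hx₁A' hp
  have h2 := h.dist_cross hc hx₁A' hq
  have h3 := h.dist_bridge_le
  have h4 := hc.dist_triangle (u := p) (v := y) (w := x₁)
  have h5 := hc.dist_triangle (u := q) (v := e) (w := x₁)
  have h6 := hc.dist_triangle (u := e) (v := e') (w := x₁)
  have h7 := hc.dist_triangle (u := y) (v := x₁) (w := e')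
  have h8 := hc.dist_triangle (u := y) (v := p) (w := e)
  have h9 := hc.dist_triangle (u := p) (v := q) (w := e)
  have h10 := hT.dist_eq_two
  have h11 := h.dist_eq
  have hτ : τ ≤ 1 := by rcases hT.kind with h1 | h1 <;> omega
  have hε : ε ≤ 1 := by rcases h.kind with h1 | h1 <;> omega
  have hcomm (a c : V) := G.dist_comm (u := a) (v := c)
  have := hcomm x₁ p
  have := hcomm x₁ q
  have := hcomm x₁ y
  have := hcomm x₁ e'
  have := hcomm e p
  have := hcomm e q
  have := hcomm e e'
  have := hcomm y p
  have := hcomm y q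
  omega

lemma tight_parity (hc : G.Connected) (h : Split G y u w e e' ε A A')
    (hT : IsTight G p q z z' x₁ x₂ τ) (hp : p ∈ A) (hq : q ∈ A) (hz : z ∈ A) (hz' : z' ∈ A)
    (hpq : |transmission G p - transmission G q| ≤ 2) : τ = ε := by
  rw [abs_le] at hpq
  rcases h.far_start hT hp hq hz hz' with h1 | h1
  · exact h.tight_parity_aux hc hT hp hq hz hz' h1 hpq.1
  · exact h.tight_parity_aux hc hT.reverse hq hp hz hz' h1 (by linarith)

lemma tight_sum_ne_zero (hc : G.Connected) (h : Split G y u w e e' ε A A')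
    (hT : IsTight G p q z z' x₁ x₂ τ) (hp : p ∈ A) (hq : q ∈ A) (hz : z ∈ A) (hz' : z' ∈ A)
    (hpq : |transmission G p - transmission G q| ≤ 2) :
    |transmission G p - transmission G q| = 2 := by
  have h1 := h.tight_parity hc hT hp hq hz hz' hpq
  have h2 := hT.four_dvd
  rw [h.card, h1] at h2
  push_cast at h2
  rw [abs_le] at hpq
  have h3 : transmission G p - transmission G q = 2 ∨ transmission G p - transmission G q = -2 := by
    omega
  rcases h3 with h3 | h3 <;> rw [h3] <;> norm_num

end Split

namespace IsBivalent

variable {V : Type*} [Fintype V] {G : SimpleGraph V} {p q z z' : V}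

lemma dist_eq_two (hc : G.Connected) (h : IsBivalent G z p q) (h' : IsBivalent G z' p q)
    (hz : z ≠ z') : G.dist z z' = 2 := by
  rw [h.dist_eq hc hz.symm, dist_eq_one_iff_adj.2 h'.adj_left.symm,
    dist_eq_one_iff_adj.2 h'.adj_right.symm]
  rfl

lemma transmission_eq (hc : G.Connected) (h : IsBivalent G z p q) (h' : IsBivalent G z' p q)
    (hz : z ≠ z') : transmission G z = transmission G z' := by
  unfold transmission
  rw [← Equiv.sum_comp (Equiv.swap z z') fun x => (G.dist z' x : ℤ)]
  refine sum_congr rfl fun x _ => ?_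
  by_cases h1 : x = z
  · subst h1
    simp
  by_cases h2 : x = z'
  · subst h2
    rw [Equiv.swap_apply_right, dist_comm]
  · rw [Equiv.swap_apply_of_ne_of_ne h1 h2, h.dist_eq hc h1, h'.dist_eq hc h2]

/-- Two bivalent twins are balanced, up to equality, as soon as a balanced vertex or edge exists. -/
lemma exists_isTight (hc : G.Connected) (h : IsBivalent G z p q) (h' : IsBivalent G z' p q)
    (hz : z ≠ z') {x₁ x₂ : V} {τ : ℕ} (hl : G.dist p x₁ + τ = G.dist q x₁)
    (hr : G.dist q x₂ + τ = G.dist p x₂)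
    (hk : (τ = 0 ∧ x₁ = x₂) ∨ (τ = 1 ∧ G.Adj x₁ x₂)) (hx₁ : x₁ ≠ z ∧ x₁ ≠ z')
    (hx₂ : x₂ ≠ z ∧ x₂ ≠ z') (hp : p ≠ x₁ ∧ p ≠ x₂)
    (hle : 2 * transmission G z - transmission G p - transmission G q ≤ 2) :
    IsTight G p q z z' x₁ x₂ τ ∧
      2 * transmission G z - transmission G p - transmission G q = 2 := by
  set s : V → ℤ := fun x => 2 * (G.dist z x : ℤ) - G.dist p x - G.dist q x with hs
  have htot : ∑ x, s x = 2 * transmission G z - transmission G p - transmission G q := by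
    rw [hs, sum_sub_distrib, sum_sub_distrib, ← mul_sum]; rfl
  have hsz : s z = -2 := h.slack_self
  have hsz' : s z' = 2 := by
    simp only [hs]
    rw [h.dist_eq_two hc h' hz, dist_eq_one_iff_adj.2 h'.adj_left.symm,
      dist_eq_one_iff_adj.2 h'.adj_right.symm]
    norm_num
  have hcompl : ∑ x ∈ ({z, z'} : Finset V)ᶜ, s x = ∑ x, s x := by
    rw [← sum_add_sum_compl {z, z'} s, sum_pair hz, hsz, hsz']
    ring
  have hsub : ({x₁, x₂} : Finset V) ⊆ ({z, z'} : Finset V)ᶜ := by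
    intro x hx
    rcases mem_insert.1 hx with rfl | hx
    · simp [hx₁]
    · rw [mem_singleton.1 hx]; simp [hx₂]
  have hnn : ∀ x ∈ ({z, z'} : Finset V)ᶜ, 0 ≤ s x := fun x hx =>
    h.slack_nonneg hc (by simp only [mem_compl, mem_insert, not_or] at hx; exact hx.1)
  have hpair : ∑ x ∈ ({x₁, x₂} : Finset V), s x = 2 := by
    have e1 := h.dist_eq hc hx₁.1
    have e2 := h.dist_eq hc hx₂.1
    rcases hk with ⟨rfl, rfl⟩ | ⟨rfl, hk⟩
    · rw [pair_eq_singleton, sum_singleton]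
      simp only [hs]
      omega
    · rw [sum_pair hk.ne]
      simp only [hs]
      omega
  have hsdiff := sum_sdiff hsub (f := s)
  have hnn' : ∀ x ∈ ({z, z'} : Finset V)ᶜ \ {x₁, x₂}, 0 ≤ s x := fun x hx =>
    hnn x (mem_sdiff.1 hx).1
  have h0 : ∑ x ∈ ({z, z'} : Finset V)ᶜ \ {x₁, x₂}, s x = 0 :=
    le_antisymm (by linarith) (sum_nonneg hnn')
  have hfar : ∀ x, x ≠ x₁ → x ≠ x₂ → x ≠ z → x ≠ z' →
      G.dist p x + 2 = G.dist q x ∨ G.dist q x + 2 = G.dist p x := by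
    intro x h1 h2 h3 h4
    have h5 := (sum_eq_zero_iff_of_nonneg hnn').1 h0 x (by simp [h1, h2, h3, h4])
    have h6 := h.dist_eq hc h3
    simp only [hs] at h5
    omega
  refine ⟨⟨h, h', hz, ?_, hl, hr, hk, hx₁, hx₂, hfar⟩, by linarith⟩
  have := hfar p hp.1 hp.2 h.adj_left.ne' h'.adj_left.ne'
  rw [dist_self, dist_comm] at this
  omega

end IsBivalent

namespace Split

variable {V : Type*} [Fintype V] {G : SimpleGraph V} {y u w e e' : V} {ε : ℕ} {A A' : Finset V}
  {O : Finset V} {p q : V} {b b' : ℕ → V}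

lemma sum_endEdges_of_length_two (hG : LowEnergy G) (h : Split G y u w e e' ε A A')
    (hP : IsPocket G A O p q 2 2 b b') :
    10 ≤ ∑ d ∈ endEdges b 2 ∪ endEdges b' 2, edgeEnergy G d ∨
      8 ≤ ∑ d ∈ endEdges b 2 ∪ endEdges b' 2, edgeEnergy G d ∧
        (∀ d ∈ endEdges b 2 ∪ endEdges b' 2, Even (edgeEnergy G d)) ∧
        (Odd (Fintype.card V) → ∃ d ∈ G.edgeFinset, Odd (edgeEnergy G d)) := by
  have hc := hG.conn
  have hb0 := hP.arc.start
  have hb2 := hP.arc.finish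
  have hb0' := hP.arc'.start
  have hb2' := hP.arc'.finish
  have hbiv : IsBivalent G (b 1) p q := by
    simpa [hb0, hb2] using hP.arc.bivalent 1 (by norm_num) (by norm_num)
  have hbiv' : IsBivalent G (b' 1) p q := by
    simpa [hb0', hb2'] using hP.arc'.bivalent 1 (by norm_num) (by norm_num)
  have hz : b 1 ≠ b' 1 := hP.disj 1 1 (by norm_num) (by norm_num) (by norm_num) (by norm_num)
  have hzz := hbiv.transmission_eq hc hbiv' hz
  have hsub : endEdges b 2 ∪ endEdges b' 2 ⊆ G.edgeFinset :=
    union_subset hP.arc.endEdges_subset hP.arc'.endEdges_subset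
  have hsum := hG.sum_le hsub
  rw [sum_union (hP.disjoint_endEdges le_rfl), hP.arc.sum_endEdges le_rfl,
    hP.arc'.sum_endEdges le_rfl] at hsum ⊢
  simp only [show 2 - 1 = 1 from rfl, ← hzz] at hsum ⊢
  have hpA : p ∈ A := hb0 ▸ hP.mem_left 0 (by norm_num)
  have hqA : q ∈ A := hb2 ▸ hP.mem_left 2 le_rfl
  have hzA : b 1 ∈ A := hP.mem_left 1 (by norm_num)
  have hzA' : b' 1 ∈ A := hP.mem_right 1 (by norm_num)
  have hne : ∀ x ∈ O, (x ≠ b 1 ∧ x ≠ b' 1) ∧ p ≠ x := fun x hx =>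
    ⟨⟨((hP.mem_iff x).1 hx).1 1 (by norm_num), ((hP.mem_iff x).1 hx).2 1 (by norm_num)⟩,
      fun e1 => hP.start_notMem (e1 ▸ hx)⟩
  have hmem : ∀ d ∈ endEdges b 2 ∪ endEdges b' 2,
      edgeEnergy G d = (transmission G (b 1) - transmission G p) ^ 2 ∨
        edgeEnergy G d = (transmission G (b 1) - transmission G q) ^ 2 := by
    intro d hd
    simp only [endEdges, mem_union, mem_insert, mem_singleton, show 2 - 1 = 1 from rfl] at hd
    rcases hd with (rfl | rfl) | rfl | rfl
    · left; rw [edgeEnergy_mk, hb0]; ring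
    · right; rw [edgeEnergy_mk, hb2]
    · left; rw [edgeEnergy_mk, hb0', hzz]; ring
    · right; rw [edgeEnergy_mk, hb2', hzz]
  by_cases hle : 2 * transmission G (b 1) - transmission G p - transmission G q ≤ 2
  · obtain ⟨x₁, x₂, τ, hT, heq⟩ : ∃ x₁ x₂ τ, IsTight G p q (b 1) (b' 1) x₁ x₂ τ ∧
        2 * transmission G (b 1) - transmission G p - transmission G q = 2 := by
      rcases hP.exists_balanced hG (mem_outside hP h.notMem_left)
        (mem_outside hP h.right_start_notMem) h.bivalent.adj_right with ⟨x, hx, h0, -⟩ |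
        ⟨x, hx, x', hx', hxx, h1, h2⟩
      · exact ⟨x, x, 0, hbiv.exists_isTight hc hbiv' hz (by omega) (by omega)
          (Or.inl ⟨rfl, rfl⟩) (hne x hx).1 (hne x hx).1 ⟨(hne x hx).2, (hne x hx).2⟩ hle⟩
      · exact ⟨x', x, 1, hbiv.exists_isTight hc hbiv' hz (by omega) (by omega)
          (Or.inr ⟨rfl, hxx.symm⟩) (hne x' hx').1 (hne x hx).1 ⟨(hne x' hx').2, (hne x hx).2⟩ hle⟩
    have habs : |transmission G p - transmission G q| ≤ 2 := by
      have h1 : (transmission G p - transmission G q) ^ 2 < 4 ^ 2 := by nlinarith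
      have h2 := abs_lt_of_sq_lt_sq h1 (by norm_num)
      rw [abs_lt] at h2
      rw [abs_le]
      omega
    have h2 := h.tight_sum_ne_zero hc hT hpA hqA hzA hzA' habs
    have hτ := h.tight_parity hc hT hpA hqA hzA hzA' habs
    have h3 : (transmission G (b 1) - transmission G p = 2 ∧
        transmission G (b 1) - transmission G q = 0) ∨
        (transmission G (b 1) - transmission G p = 0 ∧
          transmission G (b 1) - transmission G q = 2) := by
      rcases abs_cases (transmission G p - transmission G q) with h | h <;> omega
    refine Or.inr ⟨?_, fun d hd => ?_, fun hn => ?_⟩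
    · rcases h3 with ⟨h3, h4⟩ | ⟨h3, h4⟩ <;> rw [h3, h4] <;> norm_num
    · rcases h3 with ⟨h3, h4⟩ | ⟨h3, h4⟩ <;> rcases hmem d hd with h5 | h5 <;>
        rw [h5] <;> simp only [h3, h4] <;> decide
    · have hε : τ = 1 := by
        have := h.card
        rcases hT.kind with h4 | h4
        · rw [Nat.odd_iff] at hn
          omega
        · exact h4.1
      subst hε
      refine ⟨s(x₁, x₂), ?_, hT.odd_edgeEnergy hc hn⟩
      rcases hT.kind with h4 | h4
      · omega
      · simpa using h4.2
  · left
    have h1 : 3 ≤ (transmission G (b 1) - transmission G p) +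
        (transmission G (b 1) - transmission G q) := by omega
    generalize transmission G (b 1) - transmission G p = s at *
    generalize transmission G (b 1) - transmission G q = t at *
    have : 9 ≤ (s + t) ^ 2 := by nlinarith
    have : 0 ≤ (s - t) ^ 2 := sq_nonneg _
    have : 9 ≤ 2 * (s ^ 2 + t ^ 2) := by linarith
    omega

/-- The edges inside one side of the splitting contribute at least `8` to the energy, and at least
`10` if some parity condition fails. -/
lemma exists_side (hG : LowEnergy G) (h : Split G y u w e e' ε A A') :
    ∃ F ⊆ G.edgeFinset, (∀ d ∈ F, ∀ x ∈ d, x ∈ A) ∧ (10 ≤ ∑ d ∈ F, edgeEnergy G d ∨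
      8 ≤ ∑ d ∈ F, edgeEnergy G d ∧ (∀ d ∈ F, Even (edgeEnergy G d)) ∧
        (Odd (Fintype.card V) → ∃ d ∈ G.edgeFinset, Odd (edgeEnergy G d))) := by
  obtain ⟨O, p, q, k, k', b, b', hP⟩ := h.exists_pocket hG
  refine ⟨endEdges b k ∪ endEdges b' k',
    union_subset hP.arc.endEdges_subset hP.arc'.endEdges_subset,
    fun d hd => hP.mem_of_mem_endEdges hd, ?_⟩
  have hkk := h.length_eq hG hP
  have h3 := hP.three_le
  subst hkk
  rcases (show 2 ≤ k' by omega).eq_or_lt with h2 | h2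
  · subst h2
    exact h.sum_endEdges_of_length_two hG hP
  · exact Or.inl (h.sum_endEdges_ge_of_three_le hG hP h2)

end Split

namespace LowEnergy

variable {V : Type*} [Fintype V] {G : SimpleGraph V}

lemma exists_two_odd (hG : LowEnergy G) {d : Sym2 V} (hd : d ∈ G.edgeFinset)
    (hodd : Odd (edgeEnergy G d)) :
    ∃ d' ∈ G.edgeFinset, d' ≠ d ∧ Odd (edgeEnergy G d') := by
  induction d with
  | h a b =>
    have hab : G.Adj a b := by simpa using hd
    by_contra! hno
    have heven : ∀ x x', G.Adj x x' → s(x, x') ≠ s(a, b) →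
        Even (transmission G x - transmission G x') := by
      intro x x' hx hne
      have h1 := hno s(x, x') (by simpa using hx) hne
      rw [Int.not_odd_iff_even, edgeEnergy_mk, Int.even_pow] at h1
      exact h1.1
    have hwalk : ∀ {x c : V} (W : G.Walk x c), b ∉ W.support →
        Even (transmission G x - transmission G c) := by
      intro x c W hW
      induction W with
      | nil => simp
      | @cons x x' c hx W ih =>
        rw [Walk.support_cons, List.mem_cons, not_or] at hW
        have h1 := heven x x' hx fun e1 => by
          have : b ∈ s(x, x') := e1 ▸ Sym2.mem_mk_right _ _
          rcases Sym2.mem_iff.1 this with h2 | h2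
          · exact hW.1 h2
          · exact hW.2 (h2 ▸ W.start_mem_support)
        have h2 := h1.add (ih hW.2)
        rwa [sub_add_sub_cancel] at h2
    obtain ⟨c, hbc, hca⟩ := hG.exists_neighbor_ne hab.ne'
    obtain ⟨W, hW⟩ := hG.exists_walk hbc.ne' hab.ne
    have h1 := heven b c hbc fun e1 => by
      have : c ∈ s(a, b) := e1 ▸ Sym2.mem_mk_right _ _
      rcases Sym2.mem_iff.1 this with h2 | h2
      · exact hca h2
      · exact hbc.ne h2.symm
    have h2 := h1.add (hwalk W hW)
    rw [sub_add_sub_cancel] at h2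
    rw [edgeEnergy_mk, ← Int.not_even_iff_odd, Int.even_pow] at hodd
    exact hodd ⟨by rwa [← neg_sub, even_neg], by norm_num⟩

lemma energy_ge (hG : LowEnergy G) : 16 ≤ energy G ∧ Even (Fintype.card V) := by
  obtain ⟨y, u, w, e, e', ε, A, A', h⟩ := hG.exists_split
  obtain ⟨F, hF, hFA, h1⟩ := h.exists_side hG
  obtain ⟨F', hF', hFA', h1'⟩ := h.symm.exists_side hG
  have hdisj : Disjoint F F' := by
    refine disjoint_left.2 fun d hd hd' => ?_
    have hdG := hF hd
    induction d with
    | h a b =>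
      have hab : G.Adj a b := by simpa using hdG
      have ha := h.inter a (hFA _ hd a (by simp)) (hFA' _ hd' a (by simp))
      have hb := h.inter b (hFA _ hd b (by simp)) (hFA' _ hd' b (by simp))
      exact hab.ne (ha.1.trans hb.1.symm)
  have hsub : F ∪ F' ⊆ G.edgeFinset := union_subset hF hF'
  have hle := hG.sum_le hsub
  have hE : ∑ d ∈ F ∪ F', edgeEnergy G d ≤ energy G :=
    sum_le_sum_of_subset_of_nonneg hsub fun d _ _ => edgeEnergy_nonneg d
  rw [sum_union hdisj] at hle hE
  have h8 : 8 ≤ ∑ d ∈ F, edgeEnergy G d := by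
    rcases h1 with h1 | h1
    · linarith
    · exact h1.1
  have h8' : 8 ≤ ∑ d ∈ F', edgeEnergy G d := by
    rcases h1' with h1' | h1'
    · linarith
    · exact h1'.1
  refine ⟨by linarith, ?_⟩
  by_contra hn
  rw [Nat.not_even_iff_odd] at hn
  rcases h1 with h1 | ⟨-, hev, hex⟩
  · linarith
  rcases h1' with h1' | ⟨-, hev', -⟩
  · linarith
  obtain ⟨d, hd, hodd⟩ := hex hn
  obtain ⟨d', hd', hne, hodd'⟩ := hG.exists_two_odd hd hodd
  have hpos : ∀ d, Odd (edgeEnergy G d) → 1 ≤ edgeEnergy G d := by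
    intro d hd
    obtain ⟨m, hm⟩ := hd
    have := edgeEnergy_nonneg (G := G) d
    omega
  have hnot : ∀ d, Odd (edgeEnergy G d) → d ∉ F ∪ F' := by
    intro d hd hdF
    rw [← Int.not_even_iff_odd] at hd
    exact hd ((mem_union.1 hdF).elim (hev d) (hev' d))
  have hsum := hG.sum_le (F := insert d (insert d' (F ∪ F')))
    (insert_subset hd (insert_subset hd' hsub))
  rw [sum_insert (by rw [mem_insert, not_or]; exact ⟨hne.symm, hnot d hodd⟩),
    sum_insert (hnot d' hodd'), sum_union hdisj] at hsum
  have := hpos d hodd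
  have := hpos d' hodd'
  linarith

end LowEnergy

/-- Upper bound for the revised Szeged index of a connected tricyclic graph of order `n ≥ 29`. -/
theorem revSz_tricyclic_le {V : Type*} [Fintype V] (G : SimpleGraph V)
    (hconn : G.Connected) (htri : G.edgeFinset.card = Fintype.card V + 2)
    (hn : 29 ≤ Fintype.card V) :
    revSz G ≤ if Even (Fintype.card V) then
        ((Fintype.card V : ℚ) ^ 3 + 2 * (Fintype.card V : ℚ) ^ 2 - 16) / 4
      else
        ((Fintype.card V : ℚ) ^ 3 + 2 * (Fintype.card V : ℚ) ^ 2 - 18) / 4 := by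
  have hcard : (G.edgeFinset.card : ℚ) = Fintype.card V + 2 := by exact_mod_cast htri
  rw [revSz_eq hconn, hcard]
  by_cases hE : energy G ≤ 17
  · obtain ⟨h1, h2⟩ := LowEnergy.energy_ge ⟨hconn, htri, hn, hE⟩
    have h3 : (16 : ℚ) ≤ energy G := by exact_mod_cast h1
    rw [if_pos h2]
    linarith
  · have h3 : (18 : ℚ) ≤ energy G := by exact_mod_cast (not_le.1 hE)
    split_ifs <;> linarith
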